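/- arXiv:2201.08084 — 4 statements merged into one kernel-verified Lean document; each statement's English description precedes it below -/
import Mathlib

section
/- Let q be a prime power and let n, k₁, k₂, t be positive integers with n ≥ k₁ + k₂ + 1 and k₁ ≥ t, k₂ ≥ t. Suppose F₁ ⊆ M(k₁,n) and F₂ ⊆ M(k₂,n) are nonempty maximal cross t-intersecting families, i.e. F₁ = {F ∈ M(k₁,n) : dim(F ∩ G) ≥ t for all G ∈ F₂} and F₂ = {G ∈ M(k₂,n) : dim(F ∩ G) ≥ t for all F ∈ F₁}. If S₁ is a t-cover of F₁ of dimension τ_t(F₁) and S₂ is a t-cover of F₂ of dimension τ_t(F₂), then dim(S₁ ∩ S₂) ≥ t. -/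
open Module Set

/-- Gaussian binomial coefficient `[n k]_q`, as a rational number, via the
product formula `∏_{0 ≤ i < k} (q^{n-i} - 1)/(q^{k-i} - 1)`. -/
noncomputable def gaussQ (q n k : ℕ) : ℚ :=
  ∏ i ∈ Finset.range k, ((q : ℚ) ^ (n - i) - 1) / ((q : ℚ) ^ (k - i) - 1)

/-- `A` is a `k`-flat of the affine space `AG(n, q)` (with `q = |𝔽|`):
a coset `x + P` of a `k`-dimensional linear subspace `P` of `𝔽^n`. -/
def IsFlat (𝔽 : Type) [Field 𝔽] {n : ℕ} (k : ℕ) (A : Set (Fin n → 𝔽)) : Prop :=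
  ∃ (P : Submodule 𝔽 (Fin n → 𝔽)) (x : Fin n → 𝔽),
    Module.finrank 𝔽 ↥P = k ∧ A = {v | v - x ∈ P}

/-- `A` is a flat (in particular nonempty) of dimension at least `t`. -/
def DimGe (𝔽 : Type) [Field 𝔽] {n : ℕ} (t : ℕ) (A : Set (Fin n → 𝔽)) : Prop :=
  ∃ j, t ≤ j ∧ IsFlat 𝔽 j A

/-- Two families of flats are cross `t`-intersecting. -/
def CrossT (𝔽 : Type) [Field 𝔽] {n : ℕ} (t : ℕ)
    (F1 F2 : Set (Set (Fin n → 𝔽))) : Prop :=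
  ∀ A ∈ F1, ∀ B ∈ F2, DimGe 𝔽 t (A ∩ B)

/-- A pair of families is trivial: some `t`-flat is contained in every member. -/
def TrivialPair (𝔽 : Type) [Field 𝔽] {n : ℕ} (t : ℕ)
    (F1 F2 : Set (Set (Fin n → 𝔽))) : Prop :=
  ∃ T : Set (Fin n → 𝔽), IsFlat 𝔽 t T ∧ (∀ A ∈ F1, T ⊆ A) ∧ (∀ B ∈ F2, T ⊆ B)

/-- `T` is a `t`-cover of the family `F`: `dim (T ∩ A) ≥ t` for all `A ∈ F`. -/
def IsTCover (𝔽 : Type) [Field 𝔽] {n : ℕ} (t : ℕ) (T : Set (Fin n → 𝔽))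
    (F : Set (Set (Fin n → 𝔽))) : Prop :=
  ∀ A ∈ F, DimGe 𝔽 t (T ∩ A)

/-- `τ_t(F)`: the minimum dimension of a `t`-cover of `F`. -/
noncomputable def tauT (𝔽 : Type) [Field 𝔽] {n : ℕ} (t : ℕ)
    (F : Set (Set (Fin n → 𝔽))) : ℕ :=
  sInf {x | ∃ T : Set (Fin n → 𝔽), IsFlat 𝔽 x T ∧ IsTCover 𝔽 t T F}

/-- `A₁(M, T; k, t) = {F ∈ M(k,n) : T ⊆ F, dim(F ∩ M) ≥ t + 1}`. -/
def A1 (𝔽 : Type) [Field 𝔽] {n : ℕ} (M T : Set (Fin n → 𝔽)) (k t : ℕ) :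
    Set (Set (Fin n → 𝔽)) :=
  {F | IsFlat 𝔽 k F ∧ T ⊆ F ∧ DimGe 𝔽 (t + 1) (F ∩ M)}

/-- `A₂(M, T; k, t) = {F ∈ M(k,n) : T ⊆ F} ∪ {F ∈ M(k,n) : F ⊆ M, dim(F ∩ T) = t - 1}`. -/
def A2 (𝔽 : Type) [Field 𝔽] {n : ℕ} (M T : Set (Fin n → 𝔽)) (k t : ℕ) :
    Set (Set (Fin n → 𝔽)) :=
  {F | IsFlat 𝔽 k F ∧ T ⊆ F} ∪ {F | IsFlat 𝔽 k F ∧ F ⊆ M ∧ IsFlat 𝔽 (t - 1) (F ∩ T)}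

/-- `A₃(S; k) = {F ∈ M(k,n) : S ⊆ F}`. -/
def A3 (𝔽 : Type) [Field 𝔽] {n : ℕ} (S : Set (Fin n → 𝔽)) (k : ℕ) :
    Set (Set (Fin n → 𝔽)) :=
  {F | IsFlat 𝔽 k F ∧ S ⊆ F}

/-- `A₄(S; k, t) = {F ∈ M(k,n) : dim(F ∩ S) ≥ t}`. -/
def A4 (𝔽 : Type) [Field 𝔽] {n : ℕ} (S : Set (Fin n → 𝔽)) (k t : ℕ) :
    Set (Set (Fin n → 𝔽)) :=
  {F | IsFlat 𝔽 k F ∧ DimGe 𝔽 t (F ∩ S)}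

/-- A nonempty intersection of two flats is a coset of the intersection of their directions. -/
theorem flat_inter_flat {K V : Type*} [Field K] [AddCommGroup V] [Module K V]
    (P Q : Submodule K V) {x y z : V} (hx : z - x ∈ P) (hy : z - y ∈ Q) :
    {v | v - x ∈ P} ∩ {v | v - y ∈ Q} = {v | v - z ∈ P ⊓ Q} := by
  ext v
  have h1 : v - x = (v - z) + (z - x) := by abel
  have h2 : v - y = (v - z) + (z - y) := by abel
  simp only [mem_inter_iff, mem_ofPred_eq, Submodule.mem_inf, h1, h2,
    P.add_mem_iff_left hx, Q.add_mem_iff_left hy]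

/-- If `{v | v - y ∈ Q}` is contained in `{v | v - x ∈ P}`, then `Q ≤ P`. -/
theorem direction_le_of_flat_subset {K V : Type*} [Field K] [AddCommGroup V] [Module K V]
    {P Q : Submodule K V} {x y : V} (h : {v | v - y ∈ Q} ⊆ {v | v - x ∈ P}) : Q ≤ P := by
  intro w hw
  have h1 : y - x ∈ P := h (by simp)
  have h2 : w + y - x ∈ P := h (by simpa using hw)
  have h3 : w = (w + y - x) - (y - x) := by abel
  rw [h3]
  exact P.sub_mem h2 h1

/-- If the intersection of two flats contains a flat of dimension at least `t`, it is itself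
such a flat. -/
theorem DimGe.of_subset_inter {K : Type} [Field K] {n t a b : ℕ} {A B C : Set (Fin n → K)}
    (hA : IsFlat K a A) (hB : IsFlat K b B) (hC : DimGe K t C) (h : C ⊆ A ∩ B) :
    DimGe K t (A ∩ B) := by
  obtain ⟨P, x, -, rfl⟩ := hA
  obtain ⟨Q, y, -, rfl⟩ := hB
  obtain ⟨j, htj, R, z, hR, rfl⟩ := hC
  have hz := h (show z ∈ {v | v - z ∈ R} by simp)
  rw [flat_inter_flat P Q hz.1 hz.2] at h ⊢
  exact ⟨_, htj.trans (hR ▸ Submodule.finrank_mono (direction_le_of_flat_subset h)),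
    _, z, rfl, rfl⟩

/-- A subspace `U` admits disjoint subspaces of every dimension up to its codimension. -/
theorem exists_disjoint_finrank_eq {K V : Type*} [Field K] [AddCommGroup V] [Module K V]
    [FiniteDimensional K V] (U : Submodule K V) {m : ℕ} (hm : finrank K U + m ≤ finrank K V) :
    ∃ C : Submodule K V, Disjoint U C ∧ finrank K C = m := by
  obtain ⟨D, hD⟩ := U.exists_isCompl
  have hsum := Submodule.finrank_add_eq_of_isCompl hD
  obtain ⟨f, hf⟩ := exists_linearIndependent_of_le_finrank (R := K) (M := D) (n := m) (by omega)
  refine ⟨(Submodule.span K (range f)).map D.subtype,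
    hD.disjoint.mono_right (Submodule.map_subtype_le _ _), ?_⟩
  rw [Submodule.finrank_map_subtype_eq, finrank_span_eq_card hf, Fintype.card_fin]

/-- A flat `A` can be enlarged to any dimension `k` with `k + b + 1 ≤ n` without changing its
intersection with a given flat of dimension `b`. -/
theorem IsFlat.exists_superset_inter_eq {K : Type} [Field K] {n a b k : ℕ}
    {A B : Set (Fin n → K)} (hA : IsFlat K a A) (hB : IsFlat K b B) (hak : a ≤ k)
    (hn : k + b + 1 ≤ n) : ∃ G, IsFlat K k G ∧ A ⊆ G ∧ B ∩ G = A ∩ B := by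
  obtain ⟨P, x, rfl, rfl⟩ := hA
  obtain ⟨Q, y, rfl, rfl⟩ := hB
  set L := Submodule.span K {x - y}
  have hL : finrank K L ≤ 1 := (finrank_span_le_card _).trans (by simp)
  have h1 := Submodule.finrank_add_le_finrank_add_finrank P Q
  have h2 := Submodule.finrank_add_le_finrank_add_finrank (P ⊔ Q) L
  obtain ⟨C, hC, hCk⟩ := exists_disjoint_finrank_eq (P ⊔ Q ⊔ L) (m := k - finrank K P) (by
    rw [Module.finrank_fin_fun]; omega)
  have hPU : P ≤ P ⊔ Q ⊔ L := le_sup_left.trans le_sup_left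
  have hQU : Q ≤ P ⊔ Q ⊔ L := le_sup_right.trans le_sup_left
  have hxy : x - y ∈ P ⊔ Q ⊔ L :=
    Submodule.mem_sup_right (Submodule.mem_span_singleton_self _)
  have hsub : {v | v - x ∈ P} ⊆ {v | v - x ∈ P ⊔ C} := fun v hv ↦ Submodule.mem_sup_left hv
  refine ⟨{v | v - x ∈ P ⊔ C}, ⟨P ⊔ C, x, ?_, rfl⟩, hsub, ?_⟩
  · have h := Submodule.finrank_sup_add_finrank_inf_eq P C
    rw [(hC.mono_left hPU).eq_bot, finrank_bot] at h
    omega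
  · rw [inter_comm]
    refine Subset.antisymm ?_ (inter_subset_inter_left _ hsub)
    rintro v ⟨hv, hvQ⟩
    refine ⟨?_, hvQ⟩
    obtain ⟨p, hp, c, hc, hpc⟩ := Submodule.mem_sup.mp hv
    have hcU : c ∈ P ⊔ Q ⊔ L := by
      have hc' : c = (v - y) - (x - y) - p := by
        rw [eq_sub_iff_add_eq', hpc]; abel
      rw [hc']
      exact sub_mem (sub_mem (hQU hvQ) hxy) (hPU hp)
    have hc0 : c = 0 := Submodule.disjoint_def.mp hC c hcU hc
    rw [mem_ofPred_eq, ← hpc, hc0, add_zero]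
    exact hp

/-- The dimension of any `t`-cover bounds `tauT` from above. -/
theorem IsTCover.tauT_le {K : Type} [Field K] {n t k : ℕ} {T : Set (Fin n → K)}
    {F : Set (Set (Fin n → K))} (hT : IsTCover K t T F) (hk : IsFlat K k T) :
    tauT K t F ≤ k :=
  Nat.sInf_le ⟨T, hk, hT⟩

theorem stmt_13 (q : ℕ) (hq : IsPrimePow q)
    (𝔽 : Type) [Field 𝔽] [Fintype 𝔽] (hcard : Fintype.card 𝔽 = q)
    (n k1 k2 t : ℕ) (ht : 0 < t) (hk1 : t ≤ k1) (hk2 : t ≤ k2)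
    (hn : k1 + k2 + 1 ≤ n)
    (F1 F2 : Set (Set (Fin n → 𝔽))) (hne1 : F1.Nonempty) (hne2 : F2.Nonempty)
    (hmax1 : F1 = {A | IsFlat 𝔽 k1 A ∧ ∀ B ∈ F2, DimGe 𝔽 t (A ∩ B)})
    (hmax2 : F2 = {B | IsFlat 𝔽 k2 B ∧ ∀ A ∈ F1, DimGe 𝔽 t (A ∩ B)})
    (S1 S2 : Set (Fin n → 𝔽))
    (hS1 : IsFlat 𝔽 (tauT 𝔽 t F1) S1) (hS1cov : IsTCover 𝔽 t S1 F1)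
    (hS2 : IsFlat 𝔽 (tauT 𝔽 t F2) S2) (hS2cov : IsTCover 𝔽 t S2 F2) :
    DimGe 𝔽 t (S1 ∩ S2) := by
  obtain ⟨A, hA⟩ := hne1
  obtain ⟨B, hB⟩ := hne2
  have hA1 : IsFlat 𝔽 k1 A ∧ ∀ B ∈ F2, DimGe 𝔽 t (A ∩ B) := by rwa [hmax1] at hA
  have hB2 : IsFlat 𝔽 k2 B ∧ ∀ A ∈ F1, DimGe 𝔽 t (A ∩ B) := by rwa [hmax2] at hB
  have hle2 : tauT 𝔽 t F2 ≤ k1 := IsTCover.tauT_le hA1.2 hA1.1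
  have hle1 : tauT 𝔽 t F1 ≤ k2 :=
    IsTCover.tauT_le (fun A hA ↦ inter_comm A B ▸ hB2.2 A hA) hB2.1
  obtain ⟨G, hG, hSG, hinter⟩ := hS1.exists_superset_inter_eq hS2 hle1 (by omega)
  have hGF : G ∈ F2 := by
    rw [hmax2]
    refine ⟨hG, fun A hA ↦ ?_⟩
    have hAflat : IsFlat 𝔽 k1 A := by rw [hmax1] at hA; exact hA.1
    exact .of_subset_inter hAflat hG (hS1cov A hA) fun v hv ↦ ⟨hv.2, hSG hv.1⟩
  exact hinter ▸ hS2cov G hGF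
end

section
/- Let q be a prime power and let n, k₁, k₂, t be positive integers with k₁ ≥ k₂ ≥ t + 1, k₂ ≥ 2t + 1 and n ≥ k₁ + k₂ + 3. Then for every M ∈ M(k₂+1,n), every t-flat T with T ⊆ M, and every S ∈ M(t+1,n): |A₁(M,T;k₁,t)|·|A₂(M,T;k₂,t)| > |A₃(S;k₁)|·|A₄(S;k₂,t)|. -/
open Module Set

section Linear

variable {K V : Type*} [Field K] [AddCommGroup V] [Module K V]

theorem exists_linearEquiv_map_eq [FiniteDimensional K V] {D D' : Submodule K V}
    (h : finrank K D = finrank K D') : ∃ e : V ≃ₗ[K] V, D.map (e : V →ₗ[K] V) = D' := by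
  obtain ⟨C, hC⟩ := D.exists_isCompl
  obtain ⟨C', hC'⟩ := D'.exists_isCompl
  have h1 := Submodule.finrank_add_eq_of_isCompl hC
  have h2 := Submodule.finrank_add_eq_of_isCompl hC'
  let f := LinearEquiv.ofFinrankEq (R := K) D D' h
  let g := LinearEquiv.ofFinrankEq (R := K) C C' (by omega)
  let e := (Submodule.prodEquivOfIsCompl D C hC).symm ≪≫ₗ (f.prodCongr g) ≪≫ₗ
    Submodule.prodEquivOfIsCompl D' C' hC'
  refine ⟨e, Submodule.eq_of_le_of_finrank_eq ?_ ?_⟩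
  · rintro _ ⟨x, hx, rfl⟩
    have : (Submodule.prodEquivOfIsCompl D C hC).symm x = (⟨x, hx⟩, 0) :=
      Submodule.prodEquivOfIsCompl_symm_apply_left D C hC ⟨x, hx⟩
    simp [e, this]
  · rw [LinearEquiv.finrank_map_eq e D, h]

theorem mem_span_of_mem_sup_span {D U : Submodule K V} (hDU : Disjoint D U) {v w : V}
    (hv : v ∈ U) (hw : w ∈ U) (h : w ∈ D ⊔ K ∙ v) : w ∈ K ∙ v := by
  obtain ⟨d, hd, y, hy, rfl⟩ := Submodule.mem_sup.mp h
  have hyU : y ∈ U := (Submodule.span_singleton_le_iff_mem v U).mpr hv hy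
  have hdU : d ∈ U := by simpa using U.sub_mem hw hyU
  rw [Submodule.disjoint_def.mp hDU d hd hdU, zero_add]
  exact hy

variable [Finite V]

/-- The subspaces of dimension `k` that contain `D`. -/
noncomputable def subspacesAbove (D : Submodule K V) (k : ℕ) : Finset (Submodule K V) :=
  (Set.toFinite {P : Submodule K V | finrank K P = k ∧ D ≤ P}).toFinset

@[simp]
theorem mem_subspacesAbove {D P : Submodule K V} {k : ℕ} :
    P ∈ subspacesAbove D k ↔ finrank K P = k ∧ D ≤ P := by
  simp [subspacesAbove]

theorem card_subspacesAbove_eq {D D' : Submodule K V} (h : finrank K D = finrank K D') (k : ℕ) :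
    (subspacesAbove D k).card = (subspacesAbove D' k).card := by
  obtain ⟨e, he⟩ := exists_linearEquiv_map_eq h
  refine Finset.card_bij' (fun P _ => P.map (e : V →ₗ[K] V))
    (fun P _ => P.map (e.symm : V →ₗ[K] V)) ?_ ?_ ?_ ?_
  · intro P hP
    rw [mem_subspacesAbove] at hP ⊢
    exact ⟨by rw [LinearEquiv.finrank_map_eq e P, hP.1], he ▸ Submodule.map_mono hP.2⟩
  · intro P hP
    rw [mem_subspacesAbove] at hP ⊢
    refine ⟨by rw [LinearEquiv.finrank_map_eq e.symm P, hP.1], ?_⟩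
    have : D = D'.map (e.symm : V →ₗ[K] V) := by
      rw [← he, ← Submodule.map_comp]; simp
    exact this ▸ Submodule.map_mono hP.2
  · intro P _
    rw [← Submodule.map_comp]; simp
  · intro P _
    rw [← Submodule.map_comp]; simp

theorem subspacesAbove_nonempty [FiniteDimensional K V] {D : Submodule K V} {k : ℕ}
    (hD : finrank K D ≤ k) (hk : k ≤ finrank K V) : (subspacesAbove D k).Nonempty := by
  induction k, hD using Nat.le_induction with
  | base => exact ⟨D, by simp⟩
  | succ k _ ih =>
    obtain ⟨P, hP⟩ := ih (by omega)
    rw [mem_subspacesAbove] at hP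
    obtain ⟨v, hv⟩ : ∃ v, v ∉ P := by
      by_contra! h
      have : P = ⊤ := by ext; simp [h]
      rw [this, finrank_top] at hP
      omega
    exact ⟨P ⊔ K ∙ v, by
      rw [mem_subspacesAbove, Submodule.finrank_sup_span_singleton hv, hP.1]
      exact ⟨rfl, hP.2.trans le_sup_left⟩⟩

open Classical in
theorem sum_card_filter_mem_subspacesAbove (D : Submodule K V) (k : ℕ) (A : Finset V) :
    ∑ P ∈ subspacesAbove D k, (A.filter (· ∈ P)).card =
      ∑ v ∈ A, (subspacesAbove (D ⊔ K ∙ v) k).card := by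
  refine (Finset.sum_card_bipartiteAbove_eq_sum_card_bipartiteBelow (fun P v => v ∈ P)).trans ?_
  refine Finset.sum_congr rfl fun v _ => congrArg Finset.card ?_
  ext P
  simp [Finset.bipartiteBelow, and_assoc]

open Classical in
theorem sum_card_filter_mem_sq_subspacesAbove (D : Submodule K V) (k : ℕ) (A : Finset V) :
    ∑ P ∈ subspacesAbove D k, (A.filter (· ∈ P)).card ^ 2 =
      ∑ v ∈ A, ∑ w ∈ A, (subspacesAbove (D ⊔ K ∙ v ⊔ K ∙ w) k).card := by
  simp_rw [← sum_card_filter_mem_subspacesAbove]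
  simp_rw [Finset.card_filter _ A, sq, Finset.sum_mul, ite_mul, one_mul, zero_mul]
  rw [Finset.sum_comm]
  refine Finset.sum_congr rfl fun v _ => ?_
  rw [← Finset.sum_filter]
  refine Finset.sum_congr ?_ fun _ _ => rfl
  ext P
  simp [and_assoc]

theorem card_toFinset_submodule [Finite K] (P : Submodule K V) :
    (Set.toFinite (P : Set V)).toFinset.card = Nat.card K ^ finrank K P := by
  rw [← Module.natCard_eq_pow_finrank (K := K) (V := P)]
  exact (Set.ncard_eq_toFinset_card _ _).symm

theorem pow_mul_card_subspacesAbove_le [Finite K] {D D' : Submodule K V} {k : ℕ}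
    (h : finrank K D' = finrank K D + 1) (hk : finrank K D' ≤ k) (hn : k ≤ finrank K V) :
    Nat.card K ^ (finrank K V - k) * (subspacesAbove D' k).card ≤ (subspacesAbove D k).card := by
  classical
  set q := Nat.card K with hq
  have hq2 : 2 ≤ q := Finite.one_lt_card
  set d := finrank K D with hd
  set n := finrank K V with hn'
  let E := (Set.toFinite (D : Set V)).toFinset
  let A := (Set.toFinite ((⊤ : Submodule K V) : Set V)).toFinset \ E
  have key := sum_card_filter_mem_subspacesAbove D k A
  have hA : A.card = q ^ n - q ^ d := by
    rw [Finset.card_sdiff_of_subset, card_toFinset_submodule, card_toFinset_submodule, finrank_top]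
    intro x; simp
  have hr : ∑ v ∈ A, (subspacesAbove (D ⊔ K ∙ v) k).card =
      (q ^ n - q ^ d) * (subspacesAbove D' k).card := by
    rw [← hA, ← smul_eq_mul, ← Finset.sum_const]
    refine Finset.sum_congr rfl fun v hv => card_subspacesAbove_eq ?_ k
    rw [Submodule.finrank_sup_span_singleton (by simpa [A, E] using hv), h]
  have hl : ∑ P ∈ subspacesAbove D k, (A.filter (· ∈ P)).card =
      (q ^ k - q ^ d) * (subspacesAbove D k).card := by
    rw [mul_comm, ← smul_eq_mul, ← Finset.sum_const]
    refine Finset.sum_congr rfl fun P hP => ?_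
    rw [mem_subspacesAbove] at hP
    have : A.filter (· ∈ P) = (Set.toFinite (P : Set V)).toFinset \ E := by
      ext; simp [A, E, and_comm]
    rw [this, Finset.card_sdiff_of_subset, card_toFinset_submodule, card_toFinset_submodule, hP.1]
    intro x; simpa [E] using @hP.2 x
  rw [hl, hr] at key
  have hdk : q ^ d < q ^ k := Nat.pow_lt_pow_right hq2 (by omega)
  refine Nat.le_of_mul_le_mul_left ?_ (Nat.sub_pos_of_lt hdk)
  rw [key, ← mul_assoc]
  refine Nat.mul_le_mul_right _ ?_
  rw [Nat.sub_mul, ← pow_add, Nat.add_sub_cancel' hn]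
  exact Nat.sub_le_sub_left (Nat.le_mul_of_pos_right _ (by positivity)) _

open Classical in
/-- The second moment bound for the number of nonzero vectors of `U` in a random subspace
above `D`. -/
theorem card_subspacesAbove_mul_le [Finite K] {D D₁ D₂ U : Submodule K V} (k : ℕ)
    (hDU : Disjoint D U) (h₁ : finrank K D₁ = finrank K D + 1)
    (h₂ : finrank K D₂ = finrank K D + 2) :
    (Nat.card K ^ finrank K U - 1) * ((Nat.card K - 1) * (subspacesAbove D₁ k).card) ≤
      (Nat.card K - 1) ^ 2 *
        ((subspacesAbove D k).filter fun P => ∃ v ∈ U, v ≠ 0 ∧ v ∈ P).card +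
      (Nat.card K ^ finrank K U - 1) *
        ((Nat.card K ^ finrank K U - Nat.card K) * (subspacesAbove D₂ k).card) := by
  set q := Nat.card K with hq
  have hq2 : 2 ≤ q := Finite.one_lt_card
  set X := q ^ finrank K U
  set α := (subspacesAbove D₁ k).card
  set γ := (subspacesAbove D₂ k).card
  let A := (Set.toFinite (U : Set V)).toFinset \ {0}
  have memA : ∀ {v}, v ∈ A ↔ v ∈ U ∧ v ≠ 0 := by intro v; simp [A]
  have hA : A.card = X - 1 := by
    rw [Finset.card_sdiff_of_subset (by simp), card_toFinset_submodule, Finset.card_singleton]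
  have hvD : ∀ {v}, v ∈ A → v ∉ D := fun hv h =>
    (memA.mp hv).2 (Submodule.disjoint_def.mp hDU _ h (memA.mp hv).1)
  have first : ∑ P ∈ subspacesAbove D k, (A.filter (· ∈ P)).card = (X - 1) * α := by
    rw [sum_card_filter_mem_subspacesAbove, ← hA, ← smul_eq_mul, ← Finset.sum_const]
    refine Finset.sum_congr rfl fun v hv => card_subspacesAbove_eq ?_ k
    rw [Submodule.finrank_sup_span_singleton (hvD hv), h₁]
  have second : ∑ P ∈ subspacesAbove D k, (A.filter (· ∈ P)).card ^ 2 =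
      (X - 1) * ((q - 1) * α + (X - q) * γ) := by
    rw [sum_card_filter_mem_sq_subspacesAbove, ← hA, ← smul_eq_mul, ← Finset.sum_const]
    refine Finset.sum_congr rfl fun v hv => ?_
    have hvU := (memA.mp hv).1
    have hspan : (K ∙ v) ≤ U := (Submodule.span_singleton_le_iff_mem v U).mpr hvU
    have c1 : (A.filter (· ∈ K ∙ v)).card = q - 1 := by
      have : A.filter (· ∈ K ∙ v) =
          (Set.toFinite ((K ∙ v : Submodule K V) : Set V)).toFinset \ {0} := by
        ext w
        simp only [Finset.mem_filter, memA, Finset.mem_sdiff, Set.Finite.mem_toFinset,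
          SetLike.mem_coe, Finset.mem_singleton]
        exact ⟨fun h => ⟨h.2, h.1.2⟩, fun h => ⟨⟨hspan h.1, h.2⟩, h.1⟩⟩
      rw [this, Finset.card_sdiff_of_subset (by simp), card_toFinset_submodule,
        finrank_span_singleton (memA.mp hv).2, pow_one, Finset.card_singleton]
    have c2 : (A.filter (· ∉ K ∙ v)).card = X - q := by
      have := Finset.card_filter_add_card_filter_not (s := A) (· ∈ K ∙ v)
      omega
    rw [← Finset.sum_filter_add_sum_filter_not A (· ∈ K ∙ v), ← c1, ← c2, ← smul_eq_mul,
      ← smul_eq_mul, ← Finset.sum_const, ← Finset.sum_const]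
    congr 1
    · refine Finset.sum_congr rfl fun w hw => card_subspacesAbove_eq ?_ k
      have : (K ∙ w) ≤ D ⊔ K ∙ v := le_trans
        ((Submodule.span_singleton_le_iff_mem w _).mpr (Finset.mem_filter.mp hw).2) le_sup_right
      rw [sup_eq_left.mpr this, Submodule.finrank_sup_span_singleton (hvD hv), h₁]
    · refine Finset.sum_congr rfl fun w hw => card_subspacesAbove_eq ?_ k
      rw [Finset.mem_filter] at hw
      rw [Submodule.finrank_sup_span_singleton fun h => hw.2
        (mem_span_of_mem_sup_span hDU hvU (memA.mp hw.1).1 h),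
        Submodule.finrank_sup_span_singleton (hvD hv), h₂]
  have pointwise : ∑ P ∈ subspacesAbove D k, 2 * (q - 1) * (A.filter (· ∈ P)).card ≤
      ∑ P ∈ subspacesAbove D k, ((A.filter (· ∈ P)).card ^ 2 +
        if ∃ v ∈ U, v ≠ 0 ∧ v ∈ P then (q - 1) ^ 2 else 0) := by
    refine Finset.sum_le_sum fun P _ => ?_
    split_ifs with h
    · rw [add_comm]
      exact (mul_right_comm 2 (q - 1) _ ▸ two_mul_le_add_sq (q - 1) (A.filter (· ∈ P)).card)
    · have : A.filter (· ∈ P) = ∅ := by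
        refine Finset.filter_eq_empty_iff.mpr fun v hv hvP => h ⟨v, ?_⟩
        exact ⟨(memA.mp hv).1, (memA.mp hv).2, hvP⟩
      simp [this]
  rw [← Finset.mul_sum, Finset.sum_add_distrib, first, second, ← Finset.sum_filter,
    Finset.sum_const, smul_eq_mul] at pointwise
  nlinarith [pointwise]

end Linear

theorem mul_lt_mul_of_moment_bounds {q X α β γ a₁ a₂ a₄ : ℕ} (hq : 2 ≤ q) (hX : q ≤ X) (hα : 0 < α)
    (hβ : 0 < β) (hγ : X ^ 2 * γ ≤ α) (h₄ : (q - 1) * a₄ ≤ (X - q) * β) (h₂ : β ≤ a₂)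
    (h₁ : (X - 1) * ((q - 1) * α) ≤ (q - 1) ^ 2 * a₁ + (X - 1) * ((X - q) * γ)) :
    α * a₄ < a₁ * a₂ := by
  obtain ⟨p, rfl⟩ : ∃ p, q = p + 1 := ⟨q - 1, by omega⟩
  obtain ⟨Y, rfl⟩ : ∃ Y, X = Y + (p + 1) := ⟨X - (p + 1), by omega⟩
  have hXp : Y + (p + 1) - 1 = Y + p := rfl
  rw [hXp] at h₁
  simp only [Nat.add_sub_cancel] at h₁ h₄
  have hp : 1 ≤ p := by omega
  have hp2 : α ≤ p ^ 2 * α := Nat.le_mul_of_pos_left _ (by positivity)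
  have hsmall : (Y + p) * (Y * γ) < p ^ 2 * α := by
    rcases Nat.eq_zero_or_pos γ with rfl | hγ0
    · simpa using hα.trans_le hp2
    · refine lt_of_lt_of_le ?_ (hγ.trans hp2)
      nlinarith [Nat.zero_le (Y * γ), Nat.zero_le (Y * p * γ), Nat.zero_le (p * γ),
        Nat.zero_le (p * p * γ)]
  have key : Y * α < p * a₁ := by
    refine lt_of_mul_lt_mul_left (a := p) ?_ (Nat.zero_le _)
    linarith
  have : p * (α * a₄) < p * (a₁ * a₂) :=
    calc p * (α * a₄) = α * (p * a₄) := by ring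
      _ ≤ α * (Y * β) := Nat.mul_le_mul_left _ h₄
      _ = Y * α * β := by ring
      _ < p * a₁ * β := Nat.mul_lt_mul_of_pos_right key hβ
      _ ≤ p * a₁ * a₂ := Nat.mul_le_mul_left _ h₂
      _ = p * (a₁ * a₂) := by ring
  exact lt_of_mul_lt_mul_left this (Nat.zero_le _)

section Flats

variable {𝔽 : Type} [Field 𝔽] {n : ℕ}

/-- The flat through `x` with direction `P`. -/
def flatAt (P : Submodule 𝔽 (Fin n → 𝔽)) (x : Fin n → 𝔽) : Set (Fin n → 𝔽) :=
  {v | v - x ∈ P}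

@[simp]
theorem mem_flatAt {P : Submodule 𝔽 (Fin n → 𝔽)} {x v : Fin n → 𝔽} :
    v ∈ flatAt P x ↔ v - x ∈ P := Iff.rfl

theorem isFlat_flatAt (P : Submodule 𝔽 (Fin n → 𝔽)) (x : Fin n → 𝔽) :
    IsFlat 𝔽 (finrank 𝔽 P) (flatAt P x) := ⟨P, x, rfl, rfl⟩

theorem IsFlat.exists_flatAt {k : ℕ} {A : Set (Fin n → 𝔽)} (h : IsFlat 𝔽 k A) :
    ∃ P : Submodule 𝔽 (Fin n → 𝔽), ∃ x, finrank 𝔽 P = k ∧ A = flatAt P x := h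

theorem IsFlat.exists_flatAt_of_mem {k : ℕ} {A : Set (Fin n → 𝔽)} (h : IsFlat 𝔽 k A)
    {x : Fin n → 𝔽} (hx : x ∈ A) :
    ∃ P : Submodule 𝔽 (Fin n → 𝔽), finrank 𝔽 P = k ∧ A = flatAt P x := by
  obtain ⟨P, y, hP, rfl⟩ := h.exists_flatAt
  refine ⟨P, hP, ?_⟩
  ext v
  rw [mem_flatAt, mem_flatAt, ← P.sub_mem_iff_left hx, sub_sub_sub_cancel_right]

theorem self_mem_flatAt (P : Submodule 𝔽 (Fin n → 𝔽)) (x : Fin n → 𝔽) : x ∈ flatAt P x := by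
  simp

theorem flatAt_subset_flatAt {P Q : Submodule 𝔽 (Fin n → 𝔽)} {x : Fin n → 𝔽} :
    flatAt P x ⊆ flatAt Q x ↔ P ≤ Q := by
  refine ⟨fun h v hv => ?_, fun h v hv => h hv⟩
  simpa using @h (v + x) (by simpa using hv)

theorem flatAt_inter_flatAt (P Q : Submodule 𝔽 (Fin n → 𝔽)) (x : Fin n → 𝔽) :
    flatAt P x ∩ flatAt Q x = flatAt (P ⊓ Q) x := rfl

theorem flatAt_injective (x : Fin n → 𝔽) :
    Function.Injective fun P : Submodule 𝔽 (Fin n → 𝔽) => flatAt P x := fun _ _ h =>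
  le_antisymm (flatAt_subset_flatAt.mp h.le) (flatAt_subset_flatAt.mp h.ge)

/-- The hyperplane of the flat `flatAt R x` cut out by the affine equation `φ (v - x) = c`. -/
def affineHyperplane {R : Submodule 𝔽 (Fin n → 𝔽)} (x : Fin n → 𝔽) (i : Dual 𝔽 R × 𝔽) :
    Set (Fin n → 𝔽) :=
  {v | ∃ h : v - x ∈ R, i.1 ⟨v - x, h⟩ = i.2}

theorem exists_affineHyperplane_eq {R : Submodule 𝔽 (Fin n → 𝔽)} (x : Fin n → 𝔽)
    {i : Dual 𝔽 R × 𝔽} (hi : i.1 ≠ 0) :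
    ∃ (D : Submodule 𝔽 (Fin n → 𝔽)) (y : Fin n → 𝔽),
      finrank 𝔽 D + 1 = finrank 𝔽 R ∧ affineHyperplane x i = flatAt D y := by
  obtain ⟨φ, c⟩ := i
  obtain ⟨⟨s, hs⟩, hsc⟩ := LinearMap.surjective hi c
  refine ⟨φ.ker.map R.subtype, s + x, ?_, ?_⟩
  · rw [Submodule.finrank_map_subtype_eq, Module.Dual.finrank_ker_add_one_of_ne_zero hi]
  · ext v
    constructor
    · rintro ⟨h, hv⟩
      refine ⟨⟨v - x, h⟩ - ⟨s, hs⟩, ?_, ?_⟩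
      · rw [SetLike.mem_coe, LinearMap.mem_ker, map_sub, hv, hsc, sub_self]
      · simp [sub_sub, add_comm]
    · rintro ⟨⟨w, hw⟩, hwk, hwv⟩
      have hv : v - x = w + s := by
        rw [show w = v - (s + x) from hwv]
        abel
      refine ⟨hv ▸ R.add_mem hw hs, ?_⟩
      have : (⟨v - x, hv ▸ R.add_mem hw hs⟩ : R) = ⟨w, hw⟩ + ⟨s, hs⟩ := Subtype.ext hv
      rw [this, map_add, LinearMap.mem_ker.mp hwk, zero_add, hsc]

theorem exists_affineHyperplane_subset {R : Submodule 𝔽 (Fin n → 𝔽)} {x : Fin n → 𝔽} {t : ℕ}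
    {F : Set (Fin n → 𝔽)} (hR : finrank 𝔽 R = t + 1) (hF : DimGe 𝔽 t (F ∩ flatAt R x)) :
    ∃ i : Dual 𝔽 R × 𝔽, i.1 ≠ 0 ∧ affineHyperplane x i ⊆ F := by
  obtain ⟨j, hj, hG⟩ := hF
  obtain ⟨G, y, hGj, hFG⟩ := hG.exists_flatAt
  have hyF : y ∈ F ∩ flatAt R x := hFG ▸ self_mem_flatAt G y
  have hRy : flatAt R x = flatAt R y := by
    ext v
    rw [mem_flatAt, mem_flatAt, ← R.sub_mem_iff_left hyF.2, sub_sub_sub_cancel_right]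
  have hGR : G ≤ R := by
    rw [← flatAt_subset_flatAt (x := y), ← hRy, ← hFG]
    exact Set.inter_subset_right
  obtain ⟨φ, hφ, hker⟩ : ∃ φ : Dual 𝔽 R, φ ≠ 0 ∧ φ.ker ≤ G.comap R.subtype := by
    by_cases h : G.comap R.subtype = ⊤
    · have : Nontrivial R := Module.nontrivial_of_finrank_pos (R := 𝔽) (by omega)
      obtain ⟨φ, hφ⟩ := exists_ne (0 : Dual 𝔽 R)
      exact ⟨φ, hφ, h ▸ le_top⟩
    · obtain ⟨φ, hφ, hle⟩ := Submodule.exists_le_ker_of_lt_top _ (lt_top_iff_ne_top.mpr h)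
      refine ⟨φ, hφ, (Submodule.eq_of_le_of_finrank_le hle ?_).ge⟩
      have h1 := Module.Dual.finrank_ker_add_one_of_ne_zero hφ
      have h2 := (Submodule.comapSubtypeEquivOfLe hGR).finrank_eq
      omega
  refine ⟨(φ, φ ⟨y - x, hyF.2⟩), hφ, ?_⟩
  rintro v ⟨hv, hvc⟩
  have : (⟨v - x, hv⟩ - ⟨y - x, hyF.2⟩ : R) ∈ φ.ker := by
    rw [LinearMap.mem_ker, map_sub, hvc, sub_self]
  have hvG : v ∈ flatAt G y := by simpa using hker this
  rw [← hFG] at hvG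
  exact hvG.1

theorem affineHyperplane_smul {R : Submodule 𝔽 (Fin n → 𝔽)} (x : Fin n → 𝔽) {a : 𝔽} (ha : a ≠ 0)
    (i : Dual 𝔽 R × 𝔽) : affineHyperplane x (a • i) = affineHyperplane x i := by
  ext v
  simp [affineHyperplane, ha]

variable [Finite 𝔽]

theorem ncard_flats_above (D : Submodule 𝔽 (Fin n → 𝔽)) (x : Fin n → 𝔽) (k : ℕ) :
    {F | IsFlat 𝔽 k F ∧ flatAt D x ⊆ F}.ncard = (subspacesAbove D k).card := by
  rw [← Set.ncard_coe_finset, ← Set.ncard_image_of_injective _ (flatAt_injective x)]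
  congr 1
  ext F
  constructor
  · rintro ⟨hF, hDF⟩
    obtain ⟨P, hP, rfl⟩ := hF.exists_flatAt_of_mem (hDF (self_mem_flatAt D x))
    exact ⟨P, by simpa using ⟨hP, flatAt_subset_flatAt.mp hDF⟩, rfl⟩
  · rintro ⟨P, hP, rfl⟩
    rw [Finset.mem_coe, mem_subspacesAbove] at hP
    exact ⟨⟨P, x, hP.1, rfl⟩, flatAt_subset_flatAt.mpr hP.2⟩

open Classical in
theorem card_hitting_le_ncard_A1 {D W U : Submodule 𝔽 (Fin n → 𝔽)} (hDW : D ≤ W) (hUW : U ≤ W)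
    (hDU : Disjoint D U) (x : Fin n → 𝔽) (k : ℕ) :
    ((subspacesAbove D k).filter fun P => ∃ v ∈ U, v ≠ 0 ∧ v ∈ P).card ≤
      (A1 𝔽 (flatAt W x) (flatAt D x) k (finrank 𝔽 D)).ncard := by
  rw [← Set.ncard_coe_finset, ← Set.ncard_image_of_injective _ (flatAt_injective x)]
  refine Set.ncard_le_ncard ?_ (Set.toFinite _)
  rintro _ ⟨P, hP, rfl⟩
  rw [Finset.mem_coe, Finset.mem_filter, mem_subspacesAbove] at hP
  obtain ⟨⟨hPk, hDP⟩, v, hvU, hv0, hvP⟩ := hP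
  refine ⟨⟨P, x, hPk, rfl⟩, flatAt_subset_flatAt.mpr hDP, _, ?_,
    (flatAt_inter_flatAt P W x).symm ▸ isFlat_flatAt (P ⊓ W) x⟩
  rw [← Submodule.finrank_sup_span_singleton
    fun h => hv0 (Submodule.disjoint_def.mp hDU v h hvU)]
  refine Submodule.finrank_mono (sup_le (le_inf hDP hDW) ?_)
  exact (Submodule.span_singleton_le_iff_mem _ _).mpr ⟨hvP, hUW hvU⟩

theorem mul_ncard_A4_le {R D : Submodule 𝔽 (Fin n → 𝔽)} (x : Fin n → 𝔽) (k : ℕ)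
    (hD : finrank 𝔽 D + 1 = finrank 𝔽 R) :
    (Nat.card 𝔽 - 1) * (A4 𝔽 (flatAt R x) k (finrank 𝔽 D)).ncard ≤
      (Nat.card 𝔽 ^ finrank 𝔽 R - 1) * Nat.card 𝔽 * (subspacesAbove D k).card := by
  classical
  have := Fintype.ofFinite 𝔽
  have : Finite (Dual 𝔽 R) := Module.finite_of_finite 𝔽
  have := Fintype.ofFinite (Dual 𝔽 R)
  let I : Finset (Dual 𝔽 R × 𝔽) := ({0}ᶜ : Finset (Dual 𝔽 R)) ×ˢ Finset.univ
  let 𝒜 := (Set.toFinite (A4 𝔽 (flatAt R x) k (finrank 𝔽 D))).toFinset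
  have hI : I.card = (Nat.card 𝔽 ^ finrank 𝔽 R - 1) * Nat.card 𝔽 := by
    rw [Finset.card_product, Finset.card_compl, Finset.card_singleton, Finset.card_univ,
      ← Nat.card_eq_fintype_card, ← Nat.card_eq_fintype_card,
      Module.natCard_eq_pow_finrank (K := 𝔽), Subspace.dual_finrank_eq]
  have h𝒜 : (A4 𝔽 (flatAt R x) k (finrank 𝔽 D)).ncard = 𝒜.card :=
    Set.ncard_eq_toFinset_card _ _
  rw [h𝒜, ← hI, mul_comm]
  refine Finset.card_mul_le_card_mul (fun F i => affineHyperplane x i ⊆ F) ?_ ?_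
  · intro F hF
    have hF' : F ∈ A4 𝔽 (flatAt R x) k (finrank 𝔽 D) := by simpa [𝒜] using hF
    obtain ⟨i, hi, hiF⟩ := exists_affineHyperplane_subset hD.symm hF'.2
    have hi0 : i ≠ 0 := fun h => hi (by simp [h])
    have hcard : (({0}ᶜ : Finset 𝔽).image (· • i)).card = Nat.card 𝔽 - 1 := by
      rw [Finset.card_image_of_injective _ (smul_left_injective 𝔽 hi0), Finset.card_compl,
        Finset.card_singleton, Nat.card_eq_fintype_card]
    rw [← hcard]
    refine Finset.card_le_card fun j hj => ?_
    obtain ⟨a, ha, rfl⟩ := Finset.mem_image.mp hj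
    have ha0 : a ≠ 0 := by simpa using ha
    rw [Finset.mem_bipartiteAbove, affineHyperplane_smul x ha0]
    exact ⟨by simp [I, ha0, hi], hiF⟩
  · intro i hi
    have hi0 : i.1 ≠ 0 := by simpa [I] using hi
    obtain ⟨D', y, hD', hy⟩ := exists_affineHyperplane_eq x hi0
    rw [← card_subspacesAbove_eq (D := D') (by omega) k, ← ncard_flats_above D' y k, ← hy,
      ← Set.ncard_coe_finset]
    refine Set.ncard_le_ncard (fun F hF => ?_) (Set.toFinite _)
    rw [Finset.mem_coe, Finset.mem_bipartiteBelow] at hF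
    have hF' : F ∈ A4 𝔽 (flatAt R x) k (finrank 𝔽 D) := by simpa [𝒜] using hF.1
    exact ⟨hF'.1, hF.2⟩

end Flats

theorem stmt_14 (q : ℕ) (hq : IsPrimePow q)
    (𝔽 : Type) [Field 𝔽] [Fintype 𝔽] (hcard : Fintype.card 𝔽 = q)
    (n k1 k2 t : ℕ) (ht : 0 < t) (hk12 : k2 ≤ k1) (hk2 : t + 1 ≤ k2)
    (h2t : 2 * t + 1 ≤ k2) (hn : k1 + k2 + 3 ≤ n)
    (M T S : Set (Fin n → 𝔽))
    (hM : IsFlat 𝔽 (k2 + 1) M) (hT : IsFlat 𝔽 t T) (hTM : T ⊆ M)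
    (hS : IsFlat 𝔽 (t + 1) S) :
    (A3 𝔽 S k1).ncard * (A4 𝔽 S k2 t).ncard
      < (A1 𝔽 M T k1 t).ncard * (A2 𝔽 M T k2 t).ncard := by
  have hq2 : 2 ≤ q := hcard ▸ Fintype.one_lt_card
  have hq' : Nat.card 𝔽 = q := by rw [Nat.card_eq_fintype_card, hcard]
  obtain ⟨D, x, hD, rfl⟩ := hT.exists_flatAt
  obtain ⟨W, hW, rfl⟩ := hM.exists_flatAt_of_mem (hTM (self_mem_flatAt D x))
  obtain ⟨R, y, hR, rfl⟩ := hS.exists_flatAt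
  have hDW : D ≤ W := flatAt_subset_flatAt.mp hTM
  obtain ⟨U, hU, hUW, hDU⟩ : ∃ U : Submodule 𝔽 (Fin n → 𝔽),
      finrank 𝔽 U = t + 2 ∧ U ≤ W ∧ Disjoint D U := by
    obtain ⟨C, hDC, hC⟩ := IsModularLattice.exists_disjoint_and_sup_eq hDW
    have hsum := Submodule.finrank_sup_add_finrank_inf_eq D C
    rw [hC, hDC.eq_bot, finrank_bot] at hsum
    obtain ⟨U, hU⟩ := subspacesAbove_nonempty (D := (⊥ : Submodule 𝔽 C)) (k := t + 2)
      (by simp) (by omega)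
    rw [mem_subspacesAbove] at hU
    exact ⟨U.map C.subtype, by rw [Submodule.finrank_map_subtype_eq, hU.1],
      (Submodule.map_subtype_le C U).trans (hC ▸ le_sup_right),
      hDC.mono_right (Submodule.map_subtype_le C U)⟩
  have hV : finrank 𝔽 (Fin n → 𝔽) = n := by simp
  obtain ⟨D₂, hD₂⟩ := subspacesAbove_nonempty (K := 𝔽) (D := R) (k := t + 2) (by omega) (by omega)
  rw [mem_subspacesAbove] at hD₂
  have hαγ := pow_mul_card_subspacesAbove_le (D := R) (D' := D₂) (k := k1)
    (by omega) (by omega) (by omega)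
  have hα : 0 < (subspacesAbove R k1).card :=
    Finset.card_pos.mpr (subspacesAbove_nonempty (by omega) (by omega))
  have hβ : 0 < (subspacesAbove D k2).card :=
    Finset.card_pos.mpr (subspacesAbove_nonempty (by omega) (by omega))
  have h3 : (A3 𝔽 (flatAt R y) k1).ncard = (subspacesAbove R k1).card := ncard_flats_above R y k1
  have h2 : (subspacesAbove D k2).card ≤ (A2 𝔽 (flatAt W x) (flatAt D x) k2 t).ncard := by
    rw [← ncard_flats_above D x k2]
    exact Set.ncard_le_ncard Set.subset_union_left (Set.toFinite _)
  have h4 := mul_ncard_A4_le (D := D) (R := R) y k2 (by omega)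
  have hB := card_subspacesAbove_mul_le (D₁ := R) (D₂ := D₂) k1 hDU (by omega) (by omega)
  have h1 := card_hitting_le_ncard_A1 hDW hUW hDU x k1
  rw [hD] at h1 h4
  rw [hR] at h4
  rw [hU] at hB
  rw [hq'] at h4 hB hαγ
  rw [h3]
  refine mul_lt_mul_of_moment_bounds hq2 (X := q ^ (t + 2))
    (Nat.le_self_pow (by omega) q) hα hβ ?_ (h4.trans_eq ?_) h2
    (hB.trans (Nat.add_le_add_right (Nat.mul_le_mul_left _ h1) _))
  · rw [hV] at hαγ
    refine (Nat.mul_le_mul_right _ ?_).trans hαγ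
    rw [← pow_mul]
    exact Nat.pow_le_pow_right (by omega) (by omega)
  · rw [Nat.sub_mul, one_mul, ← pow_succ]
end

section
/- Let q be a prime power and let n, k₁, k₂, t be positive integers with k₁ ≥ k₂ ≥ t + 1, k₂ ≤ 2t and n ≥ k₁ + k₂ + 3. Then for every M ∈ M(k₂+1,n), every t-flat T with T ⊆ M, and every S ∈ M(t+1,n): |A₁(M,T;k₁,t)|·|A₂(M,T;k₂,t)| < |A₃(S;k₁)|·|A₄(S;k₂,t)|. -/
open Module Set

section Flats

variable {𝔽 : Type} [Field 𝔽] {n : ℕ}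

theorem IsFlat.exists_of_mem {k : ℕ} {A : Set (Fin n → 𝔽)} (hA : IsFlat 𝔽 k A)
    {y : Fin n → 𝔽} (hy : y ∈ A) :
    ∃ P : Submodule 𝔽 (Fin n → 𝔽), finrank 𝔽 P = k ∧ A = {v | v - y ∈ P} := by
  obtain ⟨P, x, hP, rfl⟩ := hA
  refine ⟨P, hP, ?_⟩
  ext v
  have h : v - x = (v - y) + (y - x) := by abel
  simp only [mem_ofPred_eq, h]
  exact P.add_mem_iff_left hy

theorem le_of_setOf_subset {P Q : Submodule 𝔽 (Fin n → 𝔽)} {x : Fin n → 𝔽}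
    (h : {v | v - x ∈ P} ⊆ {v | v - x ∈ Q}) : P ≤ Q := by
  intro p hp
  have : p + x ∈ {v | v - x ∈ Q} := h (by simpa using hp)
  simpa using this

theorem IsFlat.ncard [Fintype 𝔽] {k : ℕ} {A : Set (Fin n → 𝔽)} (hA : IsFlat 𝔽 k A) :
    A.ncard = Fintype.card 𝔽 ^ k := by
  obtain ⟨P, x, hP, rfl⟩ := hA
  have h : {v | v - x ∈ P} = (fun v => v + x) '' (P : Set (Fin n → 𝔽)) := by
    ext v
    simp [← sub_eq_add_neg]
  rw [h, ncard_image_of_injective _ (add_left_injective x), ← hP, ← Nat.card_coe_set_eq,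
    ← Nat.card_eq_fintype_card (α := 𝔽)]
  exact Module.natCard_eq_pow_finrank (K := 𝔽) (V := P)

theorem IsFlat.exists_insert {k : ℕ} {T : Set (Fin n → 𝔽)} (hT : IsFlat 𝔽 k T)
    {v : Fin n → 𝔽} (hv : v ∉ T) :
    ∃ U, IsFlat 𝔽 (k + 1) U ∧
      ∀ (m : ℕ) (F : Set (Fin n → 𝔽)), IsFlat 𝔽 m F → (U ⊆ F ↔ T ⊆ F ∧ v ∈ F) := by
  obtain ⟨P, x, rfl, rfl⟩ := hT
  refine ⟨{w | w - x ∈ P ⊔ 𝔽 ∙ (v - x)}, ⟨_, x, Submodule.finrank_sup_span_singleton hv, rfl⟩,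
    fun m F hF => ⟨fun h => ⟨fun w hw => h (Submodule.mem_sup_left hw),
      h (Submodule.mem_sup_right (Submodule.mem_span_singleton_self _))⟩, fun ⟨h, hvF⟩ => ?_⟩⟩
  have hx : x ∈ F := h (by simp)
  obtain ⟨Q, -, rfl⟩ := hF.exists_of_mem hx
  have hle : P ⊔ 𝔽 ∙ (v - x) ≤ Q :=
    sup_le (le_of_setOf_subset h) ((Submodule.span_singleton_le_iff_mem _ _).2 hvF)
  exact fun w hw => hle hw

theorem IsFlat.eq_of_subset [Fintype 𝔽] {k : ℕ} {A B : Set (Fin n → 𝔽)} (hA : IsFlat 𝔽 k A)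
    (hB : IsFlat 𝔽 k B) (h : A ⊆ B) : A = B :=
  Set.eq_of_subset_of_ncard_le h (by rw [hA.ncard, hB.ncard]) (Set.toFinite _)

theorem inter_eq_of_not_subset [Fintype 𝔽] {k m : ℕ} {U S F : Set (Fin n → 𝔽)}
    (hU : IsFlat 𝔽 k U) (hS : IsFlat 𝔽 (k + 1) S) (hF : IsFlat 𝔽 m F)
    (hUS : U ⊆ S) (hUF : U ⊆ F) (hSF : ¬ S ⊆ F) : F ∩ S = U := by
  refine subset_antisymm (fun v hv => ?_) (subset_inter hUF hUS)
  by_contra hvU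
  obtain ⟨W, hW, hWsub⟩ := hU.exists_insert hvU
  have hWS : W = S := hW.eq_of_subset hS ((hWsub _ S hS).2 ⟨hUS, hv.2⟩)
  exact hSF (hWS ▸ (hWsub _ F hF).2 ⟨hUF, hv.1⟩)

theorem IsFlat.image_affine {k : ℕ} {A : Set (Fin n → 𝔽)} (hA : IsFlat 𝔽 k A)
    (e : (Fin n → 𝔽) ≃ₗ[𝔽] (Fin n → 𝔽)) (x y : Fin n → 𝔽) :
    IsFlat 𝔽 k ((fun v => e (v - x) + y) '' A) := by
  obtain ⟨P, z, rfl, rfl⟩ := hA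
  refine ⟨P.map (e : (Fin n → 𝔽) →ₗ[𝔽] (Fin n → 𝔽)), e (z - x) + y,
    LinearEquiv.finrank_map_eq e P, ?_⟩
  ext v
  simp only [mem_image, mem_ofPred_eq, Submodule.mem_map]
  constructor
  · rintro ⟨w, hw, rfl⟩
    refine ⟨w - z, hw, ?_⟩
    simp [map_sub]
  · rintro ⟨p, hp, h⟩
    refine ⟨p + z, by simpa using hp, ?_⟩
    have h' : e p = v - (e (z - x) + y) := h
    rw [show p + z - x = p + (z - x) by abel, map_add, h']
    abel

theorem ncard_A3_le [Fintype 𝔽] {a : ℕ} {U W : Set (Fin n → 𝔽)} (hU : IsFlat 𝔽 a U)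
    (hW : IsFlat 𝔽 a W) (k : ℕ) : (A3 𝔽 U k).ncard ≤ (A3 𝔽 W k).ncard := by
  have hU' := hU
  have hW' := hW
  obtain ⟨P, x, hP, rfl⟩ := hU
  obtain ⟨Q, y, hQ, rfl⟩ := hW
  let f := LinearEquiv.ofFinrankEq P Q (hP.trans hQ.symm)
  obtain ⟨e, he⟩ := Submodule.exists_linearEquiv_restrict_eq f
  have hinj : Function.Injective (fun v => e (v - x) + y) := fun v w h => by simpa using h
  refine ncard_le_ncard_of_injOn (fun F => (fun v => e (v - x) + y) '' F) ?_
    (hinj.image_injective.injOn) (Set.toFinite _)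
  rintro F ⟨hF, hUF⟩
  refine ⟨hF.image_affine e x y, ?_⟩
  have himg : (fun v => e (v - x) + y) '' {v | v - x ∈ P} = {v | v - y ∈ Q} := by
    refine (hU'.image_affine e x y).eq_of_subset hW' ?_
    rintro _ ⟨v, hv, rfl⟩
    simp [← he ⟨v - x, hv⟩]
  exact himg ▸ image_mono hUF

theorem ncard_A3_eq [Fintype 𝔽] {a : ℕ} {U W : Set (Fin n → 𝔽)} (hU : IsFlat 𝔽 a U)
    (hW : IsFlat 𝔽 a W) (k : ℕ) : (A3 𝔽 U k).ncard = (A3 𝔽 W k).ncard :=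
  (ncard_A3_le hU hW k).antisymm (ncard_A3_le hW hU k)

theorem A3_nonempty {a k : ℕ} {U : Set (Fin n → 𝔽)} (hU : IsFlat 𝔽 a U) (hak : a ≤ k)
    (hkn : k ≤ n) : (A3 𝔽 U k).Nonempty := by
  induction k, hak using Nat.le_induction with
  | base => exact ⟨U, hU, subset_rfl⟩
  | succ k _ ih =>
    obtain ⟨F, hF, hUF⟩ := ih (by omega)
    obtain ⟨P, x, hP, rfl⟩ := hF
    have hne : P ≠ ⊤ := by
      rintro rfl
      simp at hP
      omega
    obtain ⟨v, hv⟩ := SetLike.exists_not_mem_of_ne_top P hne rfl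
    have hv' : v + x ∉ {w | w - x ∈ P} := by simpa using hv
    obtain ⟨W, hW, hsub⟩ := IsFlat.exists_insert ⟨P, x, hP, rfl⟩ hv'
    exact ⟨W, hW, hUF.trans ((hsub _ W hW).1 subset_rfl).1⟩

theorem ncard_mul_le_ncard_mul {α β : Type*} [Finite α] [Finite β] (r : α → β → Prop)
    {s : Set α} {t : Set β} {m l : ℕ} (hm : ∀ a ∈ s, m ≤ {b | b ∈ t ∧ r a b}.ncard)
    (hl : ∀ b ∈ t, {a | a ∈ s ∧ r a b}.ncard ≤ l) : s.ncard * m ≤ t.ncard * l := by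
  classical
  have := Fintype.ofFinite α
  have := Fintype.ofFinite β
  rw [ncard_eq_toFinset_card', ncard_eq_toFinset_card']
  refine Finset.card_mul_le_card_mul r (fun a ha => ?_) (fun b hb => ?_)
  · convert hm a (by simpa using ha)
    rw [ncard_eq_toFinset_card']
    congr 1
    ext b
    simp [Finset.bipartiteAbove]
  · convert hl b (by simpa using hb)
    rw [ncard_eq_toFinset_card']
    congr 1
    ext a
    simp [Finset.bipartiteBelow]

theorem ncard_setOf_A3_mem [Fintype 𝔽] {t k : ℕ} {T S : Set (Fin n → 𝔽)} (hT : IsFlat 𝔽 t T)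
    (hS : IsFlat 𝔽 (t + 1) S) {v : Fin n → 𝔽} (hv : v ∉ T) :
    {F | F ∈ A3 𝔽 T k ∧ v ∈ F}.ncard = (A3 𝔽 S k).ncard := by
  obtain ⟨U, hU, hsub⟩ := hT.exists_insert hv
  rw [← ncard_A3_eq hU hS k]
  congr 1
  ext F
  simp only [A3, mem_ofPred_eq, and_assoc]
  exact and_congr_right fun hF => (hsub k F hF).symm

theorem ncard_A1_mul_le [Fintype 𝔽] {m k t : ℕ} {M T S : Set (Fin n → 𝔽)}
    (hM : IsFlat 𝔽 m M) (hT : IsFlat 𝔽 t T) (hTM : T ⊆ M) (hS : IsFlat 𝔽 (t + 1) S) :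
    (A1 𝔽 M T k t).ncard * (Fintype.card 𝔽 ^ (t + 1) - Fintype.card 𝔽 ^ t) ≤
      (Fintype.card 𝔽 ^ m - Fintype.card 𝔽 ^ t) * (A3 𝔽 S k).ncard := by
  rw [← hM.ncard, ← hT.ncard, ← ncard_sdiff hTM]
  refine ncard_mul_le_ncard_mul (fun F v => v ∈ F) ?_ ?_
  · rintro F ⟨-, hTF, j, hj, hFM⟩
    have hset : {v | v ∈ M \ T ∧ v ∈ F} = (F ∩ M) \ T := by
      ext v
      simp only [mem_ofPred_eq, mem_sdiff, mem_inter_iff]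
      tauto
    rw [hset, ncard_sdiff (subset_inter hTF hTM), hFM.ncard]
    exact Nat.sub_le_sub_right (Nat.pow_le_pow_right Fintype.card_pos hj) _
  · rintro v ⟨-, hv⟩
    rw [← ncard_setOf_A3_mem hT hS hv]
    exact ncard_le_ncard (fun F hF => ⟨⟨hF.1.1, hF.1.2.1⟩, hF.2⟩) (Set.toFinite _)

theorem mul_ncard_A3_succ_le [Fintype 𝔽] {k t : ℕ} {T S : Set (Fin n → 𝔽)}
    (hT : IsFlat 𝔽 t T) (hS : IsFlat 𝔽 (t + 1) S) :
    (Fintype.card 𝔽 ^ n - Fintype.card 𝔽 ^ t) * (A3 𝔽 S k).ncard ≤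
      (A3 𝔽 T k).ncard * (Fintype.card 𝔽 ^ k - Fintype.card 𝔽 ^ t) := by
  have huniv : (univ : Set (Fin n → 𝔽)).ncard = Fintype.card 𝔽 ^ n := by
    simp [ncard_univ]
  rw [← huniv, ← hT.ncard, ← ncard_sdiff (subset_univ T)]
  refine ncard_mul_le_ncard_mul (fun v F => v ∈ F) ?_ ?_
  · rintro v ⟨-, hv⟩
    exact (ncard_setOf_A3_mem hT hS hv).ge
  · rintro F ⟨hF, hTF⟩
    rw [← hF.ncard, ← ncard_sdiff hTF]
    exact ncard_le_ncard (fun v hv => ⟨hv.2, hv.1.2⟩) (Set.toFinite _)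

/-- The part of the flat `y + Q` on which the functional `f`, based at `y`, takes the value `c`. -/
def flatSlice (Q : Submodule 𝔽 (Fin n → 𝔽)) (y : Fin n → 𝔽) (p : Dual 𝔽 Q × 𝔽) :
    Set (Fin n → 𝔽) :=
  {v | ∃ h : v - y ∈ Q, p.1 ⟨v - y, h⟩ = p.2}

theorem flatSlice_subset (Q : Submodule 𝔽 (Fin n → 𝔽)) (y : Fin n → 𝔽) (p : Dual 𝔽 Q × 𝔽) :
    flatSlice Q y p ⊆ {v | v - y ∈ Q} :=
  fun _ h => h.1

theorem add_mem_flatSlice {Q : Submodule 𝔽 (Fin n → 𝔽)} {y : Fin n → 𝔽} {p : Dual 𝔽 Q × 𝔽}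
    {w : Q} : (w : Fin n → 𝔽) + y ∈ flatSlice Q y p ↔ p.1 w = p.2 := by
  simp [flatSlice]

theorem isFlat_flatSlice {k : ℕ} {Q : Submodule 𝔽 (Fin n → 𝔽)} (hQ : finrank 𝔽 Q = k + 1)
    (y : Fin n → 𝔽) {p : Dual 𝔽 Q × 𝔽} (hp : p.1 ≠ 0) : IsFlat 𝔽 k (flatSlice Q y p) := by
  obtain ⟨f, c⟩ := p
  obtain ⟨w, hw⟩ := LinearMap.surjective hp c
  refine ⟨(LinearMap.ker f).map Q.subtype, (w : Fin n → 𝔽) + y, ?_, ?_⟩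
  · rw [Submodule.finrank_map_subtype_eq]
    have := Module.Dual.finrank_ker_add_one_of_ne_zero (f := f) hp
    omega
  · ext v
    simp only [flatSlice, mem_ofPred_eq, Submodule.mem_map, LinearMap.mem_ker]
    constructor
    · rintro ⟨h, hv⟩
      refine ⟨⟨v - y, h⟩ - w, by rw [map_sub, hv]; exact sub_eq_zero.2 hw.symm, ?_⟩
      simp only [map_sub, Submodule.subtype_apply]
      abel
    · rintro ⟨u, hu, huv⟩
      have huv' : v - y = ((u + w : Q) : Fin n → 𝔽) := by
        have : (u : Fin n → 𝔽) = v - (w + y) := huv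
        rw [Submodule.coe_add, this]
        abel
      refine ⟨huv' ▸ (u + w).2, ?_⟩
      have : (⟨v - y, huv' ▸ (u + w).2⟩ : Q) = u + w := Subtype.ext huv'
      rw [this, map_add, hu, hw, zero_add]

theorem exists_eq_flatSlice [Fintype 𝔽] {k : ℕ} {Q : Submodule 𝔽 (Fin n → 𝔽)}
    (hQ : finrank 𝔽 Q = k + 1) {y : Fin n → 𝔽} {F : Set (Fin n → 𝔽)} (hF : IsFlat 𝔽 k F)
    (hFQ : F ⊆ {v | v - y ∈ Q}) : ∃ p, flatSlice Q y p = F := by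
  obtain ⟨P, x, hP, rfl⟩ := hF
  have hx : x - y ∈ Q := hFQ (by simp)
  have hPQ : P ≤ Q := by
    intro p hp
    have h : p + x - y ∈ Q := hFQ (by simpa using hp)
    rw [add_sub_assoc] at h
    exact (Q.add_mem_iff_left hx).1 h
  have hlt : P.comap Q.subtype < ⊤ := by
    refine lt_top_iff_ne_top.2 fun h => ?_
    have : Q ≤ P := Submodule.comap_subtype_eq_top.1 h
    have := Submodule.finrank_mono this
    omega
  obtain ⟨f, hf, hle⟩ := Submodule.exists_le_ker_of_lt_top _ hlt
  refine ⟨(f, f ⟨x - y, hx⟩), ?_⟩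
  refine (IsFlat.eq_of_subset ⟨P, x, hP, rfl⟩ (isFlat_flatSlice hQ y hf) fun v hv => ?_).symm
  refine ⟨hFQ hv, ?_⟩
  have hmem : (⟨v - y, hFQ hv⟩ - ⟨x - y, hx⟩ : Q) ∈ P.comap Q.subtype := by
    simpa using hv
  have := hle hmem
  rw [LinearMap.mem_ker, map_sub] at this
  exact sub_eq_zero.1 this

theorem natCard_dual [Fintype 𝔽] (Q : Submodule 𝔽 (Fin n → 𝔽)) :
    Nat.card (Dual 𝔽 Q) = Fintype.card 𝔽 ^ finrank 𝔽 Q := by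
  rw [Module.natCard_eq_pow_finrank (K := 𝔽), Subspace.dual_finrank_eq,
    Nat.card_eq_fintype_card]

theorem ncard_subflats_le [Fintype 𝔽] {k : ℕ} {M : Set (Fin n → 𝔽)} (hM : IsFlat 𝔽 (k + 1) M) :
    {F | IsFlat 𝔽 k F ∧ F ⊆ M}.ncard ≤ Fintype.card 𝔽 ^ (k + 2) := by
  obtain ⟨Q, y, hQ, rfl⟩ := hM
  have hfin : Finite (Dual 𝔽 Q) := Module.finite_of_finite 𝔽
  have hsub : {F | IsFlat 𝔽 k F ∧ F ⊆ {v | v - y ∈ Q}} ⊆ flatSlice Q y '' univ := by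
    rintro F ⟨hF, hFQ⟩
    obtain ⟨p, hp⟩ := exists_eq_flatSlice hQ hF hFQ
    exact ⟨p, mem_univ p, hp⟩
  refine (ncard_le_ncard hsub (Set.toFinite _)).trans ((ncard_image_le (Set.toFinite _)).trans ?_)
  rw [ncard_univ, Nat.card_prod, natCard_dual, hQ, Nat.card_eq_fintype_card, ← pow_succ]

theorem ncard_A2_le [Fintype 𝔽] {k t : ℕ} {M T : Set (Fin n → 𝔽)} (hM : IsFlat 𝔽 (k + 1) M) :
    (A2 𝔽 M T k t).ncard ≤ (A3 𝔽 T k).ncard + Fintype.card 𝔽 ^ (k + 2) := by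
  have hsub : {F | IsFlat 𝔽 k F ∧ F ⊆ M ∧ IsFlat 𝔽 (t - 1) (F ∩ T)} ⊆
      {F | IsFlat 𝔽 k F ∧ F ⊆ M} := fun F hF => ⟨hF.1, hF.2.1⟩
  exact (ncard_union_le _ _).trans (Nat.add_le_add_left
    ((ncard_le_ncard hsub (Set.toFinite _)).trans (ncard_subflats_le hM)) _)

theorem ncard_flatSlice_fiber_le [Fintype 𝔽] (Q : Submodule 𝔽 (Fin n → 𝔽)) (y : Fin n → 𝔽)
    (U : Set (Fin n → 𝔽)) :
    {p : Dual 𝔽 Q × 𝔽 | p.1 ≠ 0 ∧ U = flatSlice Q y p}.ncard ≤ Fintype.card 𝔽 - 1 := by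
  obtain h | ⟨⟨f, c⟩, hf, rfl⟩ :=
    eq_empty_or_nonempty {p : Dual 𝔽 Q × 𝔽 | p.1 ≠ 0 ∧ U = flatSlice Q y p}
  · simp [h]
  obtain ⟨x, hx⟩ := LinearMap.surjective hf c
  obtain ⟨w, hw⟩ := LinearMap.surjective hf 1
  have key : ∀ p : Dual 𝔽 Q × 𝔽, flatSlice Q y (f, c) = flatSlice Q y p →
      p.2 = p.1 x ∧ ∀ u, p.1 u = f u * p.1 w := by
    intro p hp
    have hmem : ∀ u : Q, f u = c → p.1 u = p.2 := fun u hu =>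
      add_mem_flatSlice.1 (hp ▸ add_mem_flatSlice.2 hu)
    refine ⟨(hmem x hx).symm, fun u => ?_⟩
    have h := hmem (x + (u - f u • w)) (by simp [hx, hw])
    rw [map_add, hmem x hx, map_sub, map_smul, smul_eq_mul] at h
    linear_combination h
  have hcard : ({0}ᶜ : Set 𝔽).ncard = Fintype.card 𝔽 - 1 := by
    rw [ncard_compl, ncard_singleton, Nat.card_eq_fintype_card]
  rw [← hcard]
  refine ncard_le_ncard_of_injOn (fun p => p.1 w) ?_ ?_ (Set.toFinite _)
  · rintro p ⟨hp0, hp⟩ hpw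
    refine hp0 (LinearMap.ext fun u => ?_)
    have hpw' : p.1 w = 0 := hpw
    rw [(key p hp).2 u, hpw', mul_zero, LinearMap.zero_apply]
  · rintro p ⟨-, hp⟩ r ⟨-, hr⟩ (hpr : p.1 w = r.1 w)
    have h1 : p.1 = r.1 := LinearMap.ext fun u => by
      rw [(key p hp).2 u, (key r hr).2 u, hpr]
    exact Prod.ext h1 (by rw [(key p hp).1, (key r hr).1, h1])

theorem le_mul_ncard_A4 [Fintype 𝔽] {k t : ℕ} {T S : Set (Fin n → 𝔽)} (hT : IsFlat 𝔽 t T)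
    (hS : IsFlat 𝔽 (t + 1) S) :
    (Fintype.card 𝔽 ^ (t + 1) - 1) * Fintype.card 𝔽 * ((A3 𝔽 T k).ncard - (A3 𝔽 S k).ncard) ≤
      (A4 𝔽 S k t).ncard * (Fintype.card 𝔽 - 1) := by
  have hS' := hS
  obtain ⟨Q, y, hQ, rfl⟩ := hS
  have hfin : Finite (Dual 𝔽 Q) := Module.finite_of_finite 𝔽
  have hcard : {p : Dual 𝔽 Q × 𝔽 | p.1 ≠ 0}.ncard =
      (Fintype.card 𝔽 ^ (t + 1) - 1) * Fintype.card 𝔽 := by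
    have hset : {p : Dual 𝔽 Q × 𝔽 | p.1 ≠ 0} = ({0}ᶜ : Set (Dual 𝔽 Q)) ×ˢ univ := by
      ext p
      simp
    rw [hset, ncard_prod, ncard_compl, ncard_singleton, ncard_univ, natCard_dual, hQ,
      Nat.card_eq_fintype_card]
  rw [← hcard]
  refine ncard_mul_le_ncard_mul (fun p F => F ∩ {v | v - y ∈ Q} = flatSlice Q y p) ?_ ?_
  · intro p hp
    have hU := isFlat_flatSlice hQ y hp
    have hUS := flatSlice_subset Q y p
    rw [ncard_A3_eq hT hU k]
    refine (le_ncard_sdiff _ _ (Set.toFinite _)).trans (ncard_le_ncard ?_ (Set.toFinite _))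
    rintro F ⟨⟨hF, hUF⟩, hSF⟩
    have hinter := inter_eq_of_not_subset hU hS' hF hUS hUF fun h => hSF ⟨hF, h⟩
    exact ⟨⟨hF, t, le_rfl, hinter ▸ hU⟩, hinter⟩
  · intro F _
    exact ncard_flatSlice_fiber_le Q y _

end Flats

theorem mul_lt_mul_of_count_bounds {q n k1 k2 t a1 a2 b c a4 d : ℕ} (hq : 2 ≤ q)
    (hk12 : k2 ≤ k1) (hk2 : t + 1 ≤ k2) (h2t : k2 ≤ 2 * t) (hn : k1 + k2 + 3 ≤ n)
    (hb : 0 < b) (hd : 0 < d)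
    (h1 : a1 * (q ^ (t + 1) - q ^ t) ≤ (q ^ (k2 + 1) - q ^ t) * b)
    (h2 : a2 ≤ c + q ^ (k2 + 2))
    (h3 : (q ^ n - q ^ t) * d ≤ c * (q ^ k2 - q ^ t))
    (h4 : (q ^ (t + 1) - 1) * q * (c - d) ≤ a4 * (q - 1)) :
    a1 * a2 < b * a4 := by
  have hqt : 0 < q ^ t := by positivity
  have ha1 : a1 * (q - 1) ≤ (q ^ (t + 1) - 1) * b := by
    refine le_trans ?_ (Nat.mul_le_mul_right b (Nat.sub_le_sub_right
      (Nat.pow_le_pow_right (by omega) (show k2 + 1 - t ≤ t + 1 by omega)) 1))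
    refine Nat.le_of_mul_le_mul_left ?_ hqt
    have e1 : q ^ (t + 1) - q ^ t = q ^ t * (q - 1) := by
      rw [Nat.mul_sub, pow_succ, mul_one]
    have e2 : q ^ (k2 + 1) - q ^ t = q ^ t * (q ^ (k2 + 1 - t) - 1) := by
      rw [Nat.mul_sub, mul_one, ← pow_add, Nat.add_sub_cancel' (by omega)]
    rw [e1, e2] at h1
    linarith
  have hcd : q ^ (k1 + 3) * d ≤ c := by
    have hpos : 0 < q ^ k2 - q ^ t :=
      Nat.sub_pos_of_lt (Nat.pow_lt_pow_right (by omega) (by omega))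
    refine Nat.le_of_mul_le_mul_right ?_ hpos
    refine le_trans ?_ h3
    rw [mul_right_comm]
    refine Nat.mul_le_mul_right d ?_
    rw [Nat.mul_sub, ← pow_add]
    refine (Nat.sub_le_sub_left (Nat.le_mul_of_pos_left _ (by positivity)) _).trans
      (Nat.sub_le_sub_right (Nat.pow_le_pow_right (by omega) (by omega)) _)
  have hc1 : 2 * q ^ (k2 + 2) ≤ c := calc
    2 * q ^ (k2 + 2) ≤ q * q ^ (k2 + 2) := Nat.mul_le_mul_right _ hq
    _ = q ^ (k2 + 3) := by ring
    _ ≤ q ^ (k1 + 3) := Nat.pow_le_pow_right (by omega) (by omega)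
    _ ≤ q ^ (k1 + 3) * d := Nat.le_mul_of_pos_right _ hd
    _ ≤ c := hcd
  have hc2 : 4 * (q * d) ≤ c := calc
    4 * (q * d) ≤ q ^ 2 * (q * d) := Nat.mul_le_mul_right _ (by nlinarith)
    _ = q ^ 3 * d := by ring
    _ ≤ q ^ (k1 + 3) * d :=
      Nat.mul_le_mul_right _ (Nat.pow_le_pow_right (by omega) (by omega))
    _ ≤ c := hcd
  have hcpos : 0 < c := lt_of_lt_of_le (by positivity) hc1
  have hlt : a2 < q * (c - d) := by
    have : 2 * c ≤ q * c := Nat.mul_le_mul_right c hq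
    rw [Nat.mul_sub]
    omega
  have hpow : 0 < q ^ (t + 1) - 1 := Nat.sub_pos_of_lt (Nat.one_lt_pow (by omega) (by omega))
  refine Nat.lt_of_mul_lt_mul_right (a := q - 1) ?_
  calc a1 * a2 * (q - 1) = a1 * (q - 1) * a2 := by ring
    _ ≤ (q ^ (t + 1) - 1) * b * a2 := Nat.mul_le_mul_right _ ha1
    _ < (q ^ (t + 1) - 1) * b * (q * (c - d)) :=
      Nat.mul_lt_mul_of_pos_left hlt (Nat.mul_pos hpow hb)
    _ = b * ((q ^ (t + 1) - 1) * q * (c - d)) := by ring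
    _ ≤ b * (a4 * (q - 1)) := Nat.mul_le_mul_left _ h4
    _ = b * a4 * (q - 1) := by ring

theorem stmt_15 (q : ℕ) (hq : IsPrimePow q)
    (𝔽 : Type) [Field 𝔽] [Fintype 𝔽] (hcard : Fintype.card 𝔽 = q)
    (n k1 k2 t : ℕ) (ht : 0 < t) (hk12 : k2 ≤ k1) (hk2 : t + 1 ≤ k2)
    (h2t : k2 ≤ 2 * t) (hn : k1 + k2 + 3 ≤ n)
    (M T S : Set (Fin n → 𝔽))
    (hM : IsFlat 𝔽 (k2 + 1) M) (hT : IsFlat 𝔽 t T) (hTM : T ⊆ M)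
    (hS : IsFlat 𝔽 (t + 1) S) :
    (A1 𝔽 M T k1 t).ncard * (A2 𝔽 M T k2 t).ncard
      < (A3 𝔽 S k1).ncard * (A4 𝔽 S k2 t).ncard := by
  subst hcard
  set q := Fintype.card 𝔽 with hqdef
  have hq2 : 2 ≤ q := hq.two_le
  have h1 := ncard_A1_mul_le (k := k1) hM hT hTM hS
  have h2 := ncard_A2_le (T := T) (t := t) hM
  have h3 := mul_ncard_A3_succ_le (k := k2) hT hS
  have h4 := le_mul_ncard_A4 (k := k2) hT hS
  have hpos1 : 0 < (A3 𝔽 S k1).ncard :=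
    (ncard_pos (Set.toFinite _)).2 (A3_nonempty hS (by omega) (by omega))
  have hpos2 : 0 < (A3 𝔽 S k2).ncard :=
    (ncard_pos (Set.toFinite _)).2 (A3_nonempty hS (by omega) (by omega))
  rw [← hqdef] at h1 h2 h3 h4
  exact mul_lt_mul_of_count_bounds hq2 hk12 hk2 h2t hn hpos1 hpos2 h1 h2 h3 h4
end

section
/- Let q be a prime power and let n, k₁, k₂, t be positive integers with n ≥ k₁ + k₂ + t + 3 and k₁ > k₂ ≥ t + 1. Then for every M ∈ M(k₂+1,n) with a t-flat T ⊆ M, and every M′ ∈ M(k₁+1,n) with a t-flat T′ ⊆ M′: |A₁(M,T;k₁,t)|·|A₂(M,T;k₂,t)| > |A₁(M′,T′;k₂,t)|·|A₂(M′,T′;k₁,t)|. -/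
open Module Set

section SubspaceCounting

theorem linearIndependent_comp_iff_disjoint {K E ι E' : Type*} [Field K] [AddCommGroup E]
    [Module K E] [AddCommGroup E'] [Module K E'] (g : E →ₗ[K] E') (v : ι → E) :
    LinearIndependent K (g ∘ v) ↔
      LinearIndependent K v ∧ Disjoint (Submodule.span K (range v)) (LinearMap.ker g) := by
  constructor
  · intro h
    exact ⟨h.of_comp, Submodule.range_ker_disjoint h⟩
  · rintro ⟨h, hd⟩
    exact (g.linearIndependent_iff_of_disjoint hd).2 h

variable {K : Type*} [Field K] [Fintype K] {E : Type*} [AddCommGroup E] [Module K E]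

/-- The number of `s`-tuples that a linear map sends to linearly independent tuples. -/
theorem card_linearIndependent_comp {E' : Type*} [AddCommGroup E'] [Module K E'] [Finite E]
    (g : E →ₗ[K] E') (s : ℕ) (hs : finrank K (LinearMap.ker g) + s ≤ finrank K E) :
    Nat.card {v : Fin s → E // LinearIndependent K (g ∘ v)} =
      ∏ i ∈ Finset.range s, (Fintype.card K ^ finrank K E
        - Fintype.card K ^ (finrank K (LinearMap.ker g) + i)) := by
  have hrk := g.finrank_range_add_finrank_ker
  obtain ⟨σ, hσ⟩ := g.rangeRestrict.exists_rightInverse_of_surjective g.range_rangeRestrict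
  have hσ' : ∀ y, g (σ y) = y := fun y => congrArg Subtype.val (LinearMap.congr_fun hσ y)
  have hinj : LinearMap.ker (LinearMap.range g).subtype = ⊥ := by simp
  let e : {v : Fin s → E // LinearIndependent K (g ∘ v)} ≃
      {w : Fin s → LinearMap.range g // LinearIndependent K w} × (Fin s → LinearMap.ker g) :=
    { toFun := fun v => (⟨fun i => g.rangeRestrict (v.1 i), by
          rw [← LinearMap.linearIndependent_iff _ hinj]
          exact v.2⟩,
        fun i => ⟨v.1 i - σ (g.rangeRestrict (v.1 i)), by
          rw [LinearMap.mem_ker, map_sub, hσ']; simp⟩)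
      invFun := fun p => ⟨fun i => σ (p.1.1 i) + p.2 i, by
        have h := p.1.2
        rw [← LinearMap.linearIndependent_iff _ hinj] at h
        have h' : (g ∘ fun i => σ (p.1.1 i) + p.2 i) = (LinearMap.range g).subtype ∘ p.1.1 := by
          funext i
          simp [hσ']
        rwa [h']⟩
      left_inv := fun v => by ext i; simp
      right_inv := fun p => by
        have h : ∀ i, g.rangeRestrict (σ (p.1.1 i) + p.2 i) = p.1.1 i := fun i => by
          apply Subtype.ext
          simp [hσ']
        refine Prod.ext (Subtype.ext (funext h)) (funext fun i => Subtype.ext ?_)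
        simp only [h]
        simp }
  have : Finite (LinearMap.range g) := Finite.of_surjective _ g.surjective_rangeRestrict
  rw [Nat.card_congr e, Nat.card_prod, card_linearIndependent (by omega), Nat.card_pi,
    Finset.prod_const, Finset.card_univ, Fintype.card_fin, natCard_eq_pow_finrank (K := K),
    Nat.card_eq_fintype_card, Fin.prod_univ_eq_prod_range
      (fun i => Fintype.card K ^ finrank K (LinearMap.range g) - Fintype.card K ^ i) s,
    mul_comm, ← Finset.card_range s, ← Finset.prod_const, Finset.card_range,
    ← Finset.prod_mul_distrib]
  refine Finset.prod_congr rfl fun i _ => ?_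
  rw [Nat.mul_sub, ← pow_add, ← pow_add, add_comm, hrk]

/-- The number of subspaces of given dimension meeting `M` exactly in `W`. -/
theorem card_submodule_inf_eq [Finite E] (W M : Submodule K E) (hWM : W ≤ M) (s : ℕ)
    (hs : finrank K M + s ≤ finrank K E) :
    {Q : Submodule K E | W ≤ Q ∧ finrank K Q = finrank K W + s ∧ Q ⊓ M = W}.ncard *
      ∏ i ∈ Finset.range s, (Fintype.card K ^ (finrank K W + s)
        - Fintype.card K ^ (finrank K W + i)) =
      ∏ i ∈ Finset.range s, (Fintype.card K ^ finrank K E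
        - Fintype.card K ^ (finrank K M + i)) := by
  have hli : ∀ (N : Submodule K E) (v : Fin s → E), LinearIndependent K (N.mkQ ∘ v) ↔
      LinearIndependent K v ∧ Disjoint (Submodule.span K (range v)) N := fun N v => by
    rw [linearIndependent_comp_iff_disjoint, Submodule.ker_mkQ]
  set S := {Q : Submodule K E | W ≤ Q ∧ finrank K Q = finrank K W + s ∧ Q ⊓ M = W}
  have hrank : ∀ v : Fin s → E, LinearIndependent K (W.mkQ ∘ v) →
      finrank K ↥(W ⊔ Submodule.span K (range v)) = finrank K W + s := fun v hv => by
    have h := (hli W v).1 hv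
    have h1 := Submodule.finrank_sup_add_finrank_inf_eq W (Submodule.span K (range v))
    rw [h.2.symm.eq_bot, finrank_bot, finrank_span_eq_card h.1, Fintype.card_fin] at h1
    simpa using h1
  have hdown : ∀ v : Fin s → E, LinearIndependent K (M.mkQ ∘ v) →
      LinearIndependent K (W.mkQ ∘ v) := fun v hv => by
    rw [hli] at hv ⊢
    exact ⟨hv.1, hv.2.mono_right hWM⟩
  let f : {v : Fin s → E // LinearIndependent K (M.mkQ ∘ v)} → S := fun v =>
    ⟨W ⊔ Submodule.span K (range v.1), le_sup_left, hrank _ (hdown _ v.2), by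
      rw [sup_inf_assoc_of_le _ hWM, ((hli M v.1).1 v.2).2.eq_bot, sup_bot_eq]⟩
  have hfib : ∀ Q : S, Nat.card {v // f v = Q} =
      ∏ i ∈ Finset.range s, (Fintype.card K ^ (finrank K W + s)
        - Fintype.card K ^ (finrank K W + i)) := by
    rintro ⟨Q, hWQ, hQ, hQM⟩
    have hker : finrank K (LinearMap.ker (W.mkQ ∘ₗ Q.subtype)) = finrank K W := by
      rw [LinearMap.ker_comp, Submodule.ker_mkQ]
      exact (Submodule.comapSubtypeEquivOfLe hWQ).finrank_eq
    have h := card_linearIndependent_comp (W.mkQ ∘ₗ Q.subtype) s (by rw [hker, hQ])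
    rw [hker, hQ] at h
    rw [← h]
    refine Nat.card_congr
      { toFun := fun v => ⟨fun i => ⟨v.1.1 i, ?_⟩, ?_⟩
        invFun := fun v => ⟨⟨fun i => v.1 i, ?_⟩, ?_⟩
        left_inv := fun v => rfl
        right_inv := fun v => rfl }
    · have h1 : W ⊔ Submodule.span K (range v.1.1) = Q := congrArg Subtype.val v.2
      exact h1.le (Submodule.mem_sup_right (Submodule.subset_span ⟨i, rfl⟩))
    · exact hdown _ v.1.2
    · have h1 : LinearIndependent K (W.mkQ ∘ fun i => (v.1 i : E)) := v.2
      rw [hli] at h1 ⊢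
      refine ⟨h1.1, ?_⟩
      rw [disjoint_iff] at h1 ⊢
      have h2 : Submodule.span K (range fun i => (v.1 i : E)) ≤ Q := by
        rw [Submodule.span_le]
        rintro _ ⟨i, rfl⟩
        exact (v.1 i).2
      calc _ = Submodule.span K (range fun i => (v.1 i : E)) ⊓ Q ⊓ M := by rw [inf_eq_left.2 h2]
        _ = Submodule.span K (range fun i => (v.1 i : E)) ⊓ W := by rw [inf_assoc, hQM]
        _ = ⊥ := h1.2
    · apply Subtype.ext
      have h1 : LinearIndependent K (W.mkQ ∘ fun i => (v.1 i : E)) := v.2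
      refine Submodule.eq_of_le_of_finrank_eq (sup_le hWQ ?_) ((hrank _ h1).trans hQ.symm)
      rw [Submodule.span_le]
      rintro _ ⟨i, rfl⟩
      exact (v.1 i).2
  have hM := card_linearIndependent_comp M.mkQ s (by rwa [Submodule.ker_mkQ])
  rw [Submodule.ker_mkQ] at hM
  have := Fintype.ofFinite S
  rw [← hM, ← Nat.card_congr (Equiv.sigmaFiberEquiv f), Nat.card_sigma,
    Finset.sum_congr rfl fun Q _ => hfib Q, Finset.sum_const, smul_eq_mul, Finset.card_univ,
    ← Nat.card_coe_set_eq, Nat.card_eq_fintype_card (α := S)]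

theorem prod_range_pow_sub_pow_pos {q : ℕ} (hq : 1 < q) {a m s : ℕ} (h : m + s ≤ a) :
    0 < ∏ i ∈ Finset.range s, (q ^ a - q ^ (m + i)) := by
  refine Finset.prod_pos fun i hi => Nat.sub_pos_of_lt (Nat.pow_lt_pow_right hq ?_)
  have := Finset.mem_range.1 hi
  omega

/-- The number of hyperplanes of `P` that miss a given nonzero vector of `P`. -/
theorem card_hyperplane_notMem [Finite E] (P : Submodule K E) (k : ℕ) (hP : finrank K P = k + 1)
    {w : E} (hw : w ∈ P) (hw0 : w ≠ 0) :
    {Q : Submodule K E | Q ≤ P ∧ finrank K Q = k ∧ w ∉ Q}.ncard = Fintype.card K ^ k := by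
  set w' : P := ⟨w, hw⟩
  have hw'0 : w' ≠ 0 := fun h => hw0 (congrArg Subtype.val h)
  have himg : {Q : Submodule K E | Q ≤ P ∧ finrank K Q = k ∧ w ∉ Q} =
      Submodule.map P.subtype '' {Q : Submodule K P | (⊥ : Submodule K P) ≤ Q ∧
        finrank K Q = finrank K (⊥ : Submodule K P) + k ∧
        Q ⊓ Submodule.span K {w'} = ⊥} := by
    have hd : ∀ Q : Submodule K P, Q ⊓ Submodule.span K {w'} = ⊥ ↔ w' ∉ Q := fun Q => by
      rw [← disjoint_iff, Submodule.disjoint_span_singleton' hw'0]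
    ext Q
    constructor
    · rintro ⟨hQP, hQ, hwQ⟩
      refine ⟨Q.comap P.subtype, ⟨bot_le, ?_, ?_⟩, ?_⟩
      · rw [finrank_bot, zero_add, (Submodule.comapSubtypeEquivOfLe hQP).finrank_eq, hQ]
      · rw [hd]
        exact hwQ
      · rw [Submodule.map_comap_subtype, inf_eq_right.2 hQP]
    · rintro ⟨Q', ⟨-, hQ, hwQ⟩, rfl⟩
      rw [hd] at hwQ
      refine ⟨Submodule.map_subtype_le P Q', ?_, ?_⟩
      · rw [Submodule.finrank_map_subtype_eq, hQ, finrank_bot, zero_add]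
      · rintro ⟨y, hy, hyw⟩
        exact hwQ ((Subtype.ext hyw : y = w') ▸ hy)
  have hq : 1 < Fintype.card K := Fintype.one_lt_card
  have h := card_submodule_inf_eq (⊥ : Submodule K P) (Submodule.span K {w'}) bot_le k
    (by rw [finrank_span_singleton hw'0, hP, add_comm])
  rw [himg, ncard_image_of_injective _ (Submodule.map_injective_of_injective P.injective_subtype)]
  rw [finrank_span_singleton hw'0, hP] at h
  have hpos : 0 < ∏ i ∈ Finset.range k, (Fintype.card K ^ (finrank K (⊥ : Submodule K P) + k)
        - Fintype.card K ^ (finrank K (⊥ : Submodule K P) + i)) :=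
    prod_range_pow_sub_pow_pos hq (by rw [finrank_bot])
  apply Nat.eq_of_mul_eq_mul_right hpos
  rw [h, ← Finset.card_range k, ← Finset.prod_const, Finset.card_range, ← Finset.prod_mul_distrib]
  refine Finset.prod_congr rfl fun i _ => ?_
  rw [Nat.mul_sub, finrank_bot, zero_add, zero_add, pow_succ', pow_add, pow_one]

end SubspaceCounting

section Arithmetic

/-- Recursion in `k` for the number of ways to complete a basis of a `t`-space to a basis of a
`k`-space. -/
theorem prod_Ico_pow_sub_pow_succ (q : ℕ) {t k : ℕ} (h : t ≤ k) :
    ∏ i ∈ Finset.Ico t (k + 1), (q ^ (k + 1) - q ^ i) =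
      (∏ i ∈ Finset.Ico t k, (q ^ k - q ^ i)) * (q ^ k * (q ^ (k + 1 - t) - 1)) := by
  have h1 : ∏ i ∈ Finset.Ico (t + 1) (k + 1), (q ^ (k + 1) - q ^ i) =
      q ^ (k - t) * ∏ i ∈ Finset.Ico t k, (q ^ k - q ^ i) := by
    rw [← Finset.prod_Ico_add' (fun i => q ^ (k + 1) - q ^ i) t k 1, ← Nat.card_Ico t k,
      ← Finset.prod_const, ← Finset.prod_mul_distrib]
    refine Finset.prod_congr rfl fun i _ => ?_
    rw [Nat.mul_sub, pow_succ', pow_succ']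
  have h2 : q ^ (k + 1) - q ^ t = q ^ t * (q ^ (k + 1 - t) - 1) := by
    rw [Nat.mul_sub, ← pow_add, mul_one]
    congr 2
    omega
  have h3 : q ^ k = q ^ t * q ^ (k - t) := by
    rw [← pow_add]
    congr 1
    omega
  rw [Finset.prod_eq_prod_Ico_succ_bot (by omega), h1, h2, h3]
  ring

theorem prod_Ico_pow_sub_pow_ratio (q : ℕ) {t k l : ℕ} (h : t ≤ k) (hkl : k ≤ l) :
    ∏ i ∈ Finset.Ico t l, (q ^ l - q ^ i) = (∏ i ∈ Finset.Ico t k, (q ^ k - q ^ i)) *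
      ∏ i ∈ Finset.Ico k l, (q ^ i * (q ^ (i + 1 - t) - 1)) := by
  induction l, hkl using Nat.le_induction with
  | base => simp
  | succ l hkl ih =>
    rw [prod_Ico_pow_sub_pow_succ q (h.trans hkl), ih, Finset.prod_Ico_succ_top hkl, mul_assoc]

theorem prod_Ico_pos_of_lt {q : ℕ} (hq : 1 < q) {n a b : ℕ} (h : b ≤ n) :
    0 < ∏ i ∈ Finset.Ico a b, (q ^ n - q ^ i) :=
  Finset.prod_pos fun i hi => Nat.sub_pos_of_lt <| Nat.pow_lt_pow_right hq <| by
    have := Finset.mem_Ico.1 hi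
    omega

/-- The number of `l`-spaces over a `t`-space exceeds that of `k`-spaces by a factor of at least
`q ^ (l - k)`, for `0 < t ≤ k ≤ l` and `k + l ≤ n`. -/
theorem pow_mul_card_le {q : ℕ} (hq : 1 < q) {n t k l A B : ℕ} (h : t ≤ k) (hkl : k ≤ l)
    (hn : k + l ≤ n)
    (hA : A * ∏ i ∈ Finset.Ico t l, (q ^ l - q ^ i) = ∏ i ∈ Finset.Ico t l, (q ^ n - q ^ i))
    (hB : B * ∏ i ∈ Finset.Ico t k, (q ^ k - q ^ i) = ∏ i ∈ Finset.Ico t k, (q ^ n - q ^ i))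
    (ht : 0 < t) : q ^ (l - k) * B ≤ A := by
  rw [prod_Ico_pow_sub_pow_ratio q h hkl, ← Finset.prod_Ico_consecutive _ h hkl, ← hB] at hA
  have hc := prod_Ico_pos_of_lt (a := t) hq le_rfl (b := k)
  have hP : 0 < ∏ i ∈ Finset.Ico k l, q ^ i := Finset.prod_pos fun i _ => by positivity
  have hD : 0 < ∏ i ∈ Finset.Ico k l, (q ^ (i + 1 - t) - 1) :=
    Finset.prod_pos fun i hi => Nat.sub_pos_of_lt <| Nat.one_lt_pow (by
      have := Finset.mem_Ico.1 hi
      omega) hq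
  have hfac : ∏ i ∈ Finset.Ico k l, (q ^ n - q ^ i) =
      (∏ i ∈ Finset.Ico k l, q ^ i) * ∏ i ∈ Finset.Ico k l, (q ^ (n - i) - 1) := by
    rw [← Finset.prod_mul_distrib]
    refine Finset.prod_congr rfl fun i hi => ?_
    have := Finset.mem_Ico.1 hi
    rw [Nat.mul_sub, ← pow_add, mul_one]
    congr 2
    omega
  have hrefl : ∏ i ∈ Finset.Ico k l, (q ^ (n - i) - 1) =
      ∏ i ∈ Finset.Ico k l, (q ^ (n + 1 + i - k - l) - 1) := by
    rw [Finset.prod_Ico_eq_prod_range, Finset.prod_Ico_eq_prod_range, ← Finset.prod_range_reflect]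
    refine Finset.prod_congr rfl fun i hi => ?_
    have := Finset.mem_range.1 hi
    congr 2
    omega
  have hle : q ^ (l - k) * ∏ i ∈ Finset.Ico k l, (q ^ (i + 1 - t) - 1) ≤
      ∏ i ∈ Finset.Ico k l, (q ^ (n - i) - 1) := by
    rw [hrefl, ← Nat.card_Ico k l, ← Finset.prod_const, ← Finset.prod_mul_distrib]
    refine Finset.prod_le_prod' fun i hi => ?_
    have := Finset.mem_Ico.1 hi
    rw [Nat.mul_sub, ← pow_succ']
    exact tsub_le_tsub (Nat.pow_le_pow_right hq.le (by omega)) (by omega)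
  rw [Finset.prod_mul_distrib, hfac] at hA
  have hA' : A * ∏ i ∈ Finset.Ico k l, (q ^ (i + 1 - t) - 1) =
      B * ∏ i ∈ Finset.Ico k l, (q ^ (n - i) - 1) := by
    apply Nat.eq_of_mul_eq_mul_left (Nat.mul_pos hc hP)
    linear_combination hA
  refine Nat.le_of_mul_le_mul_right ?_ hD
  calc _ = B * (q ^ (l - k) * ∏ i ∈ Finset.Ico k l, (q ^ (i + 1 - t) - 1)) := by ring
    _ ≤ _ := Nat.mul_le_mul_left B hle
    _ = _ := hA'.symm

/-- Comparison of the numbers of subspaces meeting a given one trivially. -/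
theorem prod_avoid_lt {q : ℕ} (hq : 1 < q) {n t k l e : ℕ} (h : t ≤ k) (hkl : k < l) (hle : l < e)
    (hn : e ≤ n) :
    (∏ i ∈ Finset.Ico (k + 1) e, (q ^ n - q ^ i)) * ∏ i ∈ Finset.Ico t k, (q ^ n - q ^ i) <
      (∏ i ∈ Finset.Ico (l + 1) e, (q ^ n - q ^ i)) * ∏ i ∈ Finset.Ico t l, (q ^ n - q ^ i) := by
  have hk := Finset.prod_Ico_consecutive (fun i => q ^ n - q ^ i) h (show k ≤ e by omega)
  have hl := Finset.prod_Ico_consecutive (fun i => q ^ n - q ^ i) (show t ≤ l by omega) hle.le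
  rw [Finset.prod_eq_prod_Ico_succ_bot (show k < e by omega)] at hk
  rw [Finset.prod_eq_prod_Ico_succ_bot hle, ← hk] at hl
  have hpos : 0 < (∏ i ∈ Finset.Ico (k + 1) e, (q ^ n - q ^ i)) *
      ∏ i ∈ Finset.Ico t k, (q ^ n - q ^ i) :=
    Nat.mul_pos (prod_Ico_pos_of_lt hq hn) (prod_Ico_pos_of_lt hq (by omega))
  have h1 : q ^ k < q ^ l := Nat.pow_lt_pow_right hq hkl
  have h2 : q ^ l < q ^ n := Nat.pow_lt_pow_right hq (by omega)
  refine Nat.lt_of_mul_lt_mul_right (a := q ^ n - q ^ l) ?_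
  calc _ < ((∏ i ∈ Finset.Ico (k + 1) e, (q ^ n - q ^ i)) *
      ∏ i ∈ Finset.Ico t k, (q ^ n - q ^ i)) * (q ^ n - q ^ k) :=
        Nat.mul_lt_mul_of_pos_left (by omega) hpos
    _ = _ := by linear_combination -hl

theorem sub_mul_add_lt {A B a b h h' : ℕ} (hb : b ≤ B) (ha : a ≤ A)
    (h1 : a * B < b * A) (h2 : h' * B ≤ h * A) : (B - b) * (A + h') < (A - a) * (B + h) := by
  obtain ⟨c, rfl⟩ := Nat.exists_eq_add_of_le hb
  obtain ⟨d, rfl⟩ := Nat.exists_eq_add_of_le ha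
  simp only [Nat.add_sub_cancel_left]
  have hpos : 0 < (a + d) * (b + c) := by
    have : 0 < a + d := Nat.pos_of_ne_zero fun h0 => by simp [h0] at h1
    have : 0 < b := Nat.pos_of_ne_zero fun h0 => by simp [h0] at h1
    positivity
  have h3 : c * (a + d) < d * (b + c) := by nlinarith
  have h4 : c * h' ≤ d * h := by
    refine Nat.le_of_mul_le_mul_right ?_ hpos
    calc _ = (c * (a + d)) * (h' * (b + c)) := by ring
      _ ≤ (d * (b + c)) * (h * (a + d)) := Nat.mul_le_mul h3.le h2
      _ = _ := by ring
  nlinarith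

end Arithmetic

section Flats

variable {𝔽 : Type} [Field 𝔽] {n : ℕ}

/-- The flat through `p` with direction `Q`. -/
def flatThrough (p : Fin n → 𝔽) (Q : Submodule 𝔽 (Fin n → 𝔽)) : Set (Fin n → 𝔽) :=
  {v | v - p ∈ Q}

theorem mem_flatThrough {p v : Fin n → 𝔽} {Q : Submodule 𝔽 (Fin n → 𝔽)} :
    v ∈ flatThrough p Q ↔ v - p ∈ Q := Iff.rfl

theorem self_mem_flatThrough (p : Fin n → 𝔽) (Q : Submodule 𝔽 (Fin n → 𝔽)) :
    p ∈ flatThrough p Q := by simp [mem_flatThrough]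

theorem flatThrough_eq_of_mem {p x : Fin n → 𝔽} {Q : Submodule 𝔽 (Fin n → 𝔽)}
    (h : p ∈ flatThrough x Q) : flatThrough x Q = flatThrough p Q := by
  ext v
  rw [mem_flatThrough, mem_flatThrough, ← Q.sub_mem_iff_left h, sub_sub_sub_cancel_right]

theorem flatThrough_subset_iff {p : Fin n → 𝔽} {P Q : Submodule 𝔽 (Fin n → 𝔽)} :
    flatThrough p P ⊆ flatThrough p Q ↔ P ≤ Q := by
  refine ⟨fun h v hv => ?_, fun h v hv => h hv⟩
  have h1 : v + p ∈ flatThrough p P := by simpa [mem_flatThrough] using hv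
  simpa [mem_flatThrough] using h h1

theorem flatThrough_injective (p : Fin n → 𝔽) :
    Function.Injective (flatThrough p) := fun _ _ h =>
  le_antisymm (flatThrough_subset_iff.1 h.le) (flatThrough_subset_iff.1 h.ge)

theorem flatThrough_inter (p : Fin n → 𝔽) (P Q : Submodule 𝔽 (Fin n → 𝔽)) :
    flatThrough p P ∩ flatThrough p Q = flatThrough p (P ⊓ Q) := rfl

theorem isFlat_flatThrough {p : Fin n → 𝔽} {Q : Submodule 𝔽 (Fin n → 𝔽)} {k : ℕ} :
    IsFlat 𝔽 k (flatThrough p Q) ↔ finrank 𝔽 Q = k := by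
  refine ⟨?_, fun h => ⟨Q, p, h, rfl⟩⟩
  rintro ⟨P, x, hP, h⟩
  have hp : p ∈ flatThrough x P := h.le (self_mem_flatThrough p Q)
  rw [flatThrough_injective p (h.trans (flatThrough_eq_of_mem hp)), hP]

theorem IsFlat.exists_eq_flatThrough {k : ℕ} {A : Set (Fin n → 𝔽)} (h : IsFlat 𝔽 k A)
    {p : Fin n → 𝔽} (hp : p ∈ A) :
    ∃ Q : Submodule 𝔽 (Fin n → 𝔽), finrank 𝔽 Q = k ∧ A = flatThrough p Q := by
  obtain ⟨P, x, hP, rfl⟩ := h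
  exact ⟨P, hP, flatThrough_eq_of_mem hp⟩

theorem IsFlat.nonempty {k : ℕ} {A : Set (Fin n → 𝔽)} (h : IsFlat 𝔽 k A) : A.Nonempty := by
  obtain ⟨P, x, hP, rfl⟩ := h
  exact ⟨x, self_mem_flatThrough x P⟩

theorem dimGe_flatThrough {p : Fin n → 𝔽} {Q : Submodule 𝔽 (Fin n → 𝔽)} {k : ℕ} :
    DimGe 𝔽 k (flatThrough p Q) ↔ k ≤ finrank 𝔽 Q := by
  simp [DimGe, isFlat_flatThrough]

theorem ncard_flatThrough [Fintype 𝔽] (p : Fin n → 𝔽) (Q : Submodule 𝔽 (Fin n → 𝔽)) :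
    (flatThrough p Q).ncard = Fintype.card 𝔽 ^ finrank 𝔽 Q := by
  have h : flatThrough p Q = (fun v => v + p) '' (Q : Set (Fin n → 𝔽)) := by
    ext v
    simp [mem_flatThrough, sub_eq_add_neg]
  rw [h, ncard_image_of_injective _ (add_left_injective p), ← Nat.card_coe_set_eq,
    ← Nat.card_eq_fintype_card (α := 𝔽)]
  exact natCard_eq_pow_finrank

theorem IsFlat.ncard_eq [Fintype 𝔽] {k : ℕ} {A : Set (Fin n → 𝔽)} (h : IsFlat 𝔽 k A) :
    A.ncard = Fintype.card 𝔽 ^ k := by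
  obtain ⟨P, x, rfl, rfl⟩ := h
  exact ncard_flatThrough x P

theorem setOf_isFlat_flatThrough_subset (p : Fin n → 𝔽) (W : Submodule 𝔽 (Fin n → 𝔽)) (k : ℕ) :
    {F | IsFlat 𝔽 k F ∧ flatThrough p W ⊆ F} =
      flatThrough p '' {Q | W ≤ Q ∧ finrank 𝔽 Q = k} := by
  ext F
  constructor
  · rintro ⟨hF, hWF⟩
    obtain ⟨Q, hQ, rfl⟩ := hF.exists_eq_flatThrough (hWF (self_mem_flatThrough p W))
    exact ⟨Q, ⟨flatThrough_subset_iff.1 hWF, hQ⟩, rfl⟩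
  · rintro ⟨Q, ⟨hWQ, hQ⟩, rfl⟩
    exact ⟨isFlat_flatThrough.2 hQ, flatThrough_subset_iff.2 hWQ⟩

theorem A1_flatThrough (p : Fin n → 𝔽) {W P : Submodule 𝔽 (Fin n → 𝔽)} (hWP : W ≤ P) (k : ℕ) :
    A1 𝔽 (flatThrough p P) (flatThrough p W) k (finrank 𝔽 W) =
      flatThrough p '' ({Q | W ≤ Q ∧ finrank 𝔽 Q = k} \
        {Q | W ≤ Q ∧ finrank 𝔽 Q = k ∧ Q ⊓ P = W}) := by
  have key : ∀ Q : Submodule 𝔽 (Fin n → 𝔽), W ≤ Q →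
      (finrank 𝔽 W + 1 ≤ finrank 𝔽 ↥(Q ⊓ P) ↔ Q ⊓ P ≠ W) := fun Q hWQ => by
    constructor
    · intro h h'
      rw [h'] at h
      omega
    · intro h
      exact Submodule.finrank_lt_finrank_of_lt (lt_of_le_of_ne (le_inf hWQ hWP) h.symm)
  ext F
  constructor
  · rintro ⟨hF, hWF, hD⟩
    obtain ⟨Q, hQ, rfl⟩ := hF.exists_eq_flatThrough (hWF (self_mem_flatThrough p W))
    have hWQ := flatThrough_subset_iff.1 hWF
    rw [flatThrough_inter, dimGe_flatThrough, key Q hWQ] at hD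
    exact ⟨Q, ⟨⟨hWQ, hQ⟩, fun h => hD h.2.2⟩, rfl⟩
  · rintro ⟨Q, ⟨⟨hWQ, hQ⟩, hD⟩, rfl⟩
    refine ⟨isFlat_flatThrough.2 hQ, flatThrough_subset_iff.2 hWQ, ?_⟩
    rw [flatThrough_inter, dimGe_flatThrough, key Q hWQ]
    exact fun h => hD ⟨hWQ, hQ, h⟩

theorem ncard_A1 [Fintype 𝔽] (p : Fin n → 𝔽) {W P : Submodule 𝔽 (Fin n → 𝔽)} (hWP : W ≤ P)
    (k : ℕ) :
    (A1 𝔽 (flatThrough p P) (flatThrough p W) k (finrank 𝔽 W)).ncard =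
      {Q : Submodule 𝔽 (Fin n → 𝔽) | W ≤ Q ∧ finrank 𝔽 Q = k}.ncard -
        {Q : Submodule 𝔽 (Fin n → 𝔽) | W ≤ Q ∧ finrank 𝔽 Q = k ∧ Q ⊓ P = W}.ncard := by
  rw [A1_flatThrough p hWP, ncard_image_of_injective _ (flatThrough_injective p), ncard_sdiff]
  exact fun Q hQ => ⟨hQ.1, hQ.2.1⟩

theorem ncard_submodule_ge [Fintype 𝔽] (W : Submodule 𝔽 (Fin n → 𝔽)) {k : ℕ}
    (hWk : finrank 𝔽 W ≤ k) (hk : k ≤ n) :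
    {Q : Submodule 𝔽 (Fin n → 𝔽) | W ≤ Q ∧ finrank 𝔽 Q = k}.ncard *
      ∏ i ∈ Finset.Ico (finrank 𝔽 W) k, (Fintype.card 𝔽 ^ k - Fintype.card 𝔽 ^ i) =
      ∏ i ∈ Finset.Ico (finrank 𝔽 W) k, (Fintype.card 𝔽 ^ n - Fintype.card 𝔽 ^ i) := by
  obtain ⟨s, rfl⟩ := Nat.exists_eq_add_of_le hWk
  have h := card_submodule_inf_eq W W le_rfl s (by simpa using hk)
  rw [finrank_fin_fun] at h
  rw [Finset.prod_Ico_eq_prod_range, Finset.prod_Ico_eq_prod_range, Nat.add_sub_cancel_left, ← h]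
  congr 2
  ext Q
  exact ⟨fun hQ => ⟨hQ.1, hQ.2, inf_eq_right.2 hQ.1⟩, fun hQ => ⟨hQ.1, hQ.2.1⟩⟩

theorem ncard_submodule_inf_eq [Fintype 𝔽] {W P : Submodule 𝔽 (Fin n → 𝔽)} (hWP : W ≤ P)
    {k : ℕ} (hWk : finrank 𝔽 W ≤ k) (hk : finrank 𝔽 P + k ≤ n + finrank 𝔽 W) :
    {Q : Submodule 𝔽 (Fin n → 𝔽) | W ≤ Q ∧ finrank 𝔽 Q = k ∧ Q ⊓ P = W}.ncard *
      ∏ i ∈ Finset.Ico (finrank 𝔽 W) k, (Fintype.card 𝔽 ^ k - Fintype.card 𝔽 ^ i) =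
      ∏ i ∈ Finset.Ico (finrank 𝔽 P) (finrank 𝔽 P + k - finrank 𝔽 W),
        (Fintype.card 𝔽 ^ n - Fintype.card 𝔽 ^ i) := by
  obtain ⟨s, rfl⟩ := Nat.exists_eq_add_of_le hWk
  have h := card_submodule_inf_eq W P hWP s (by rw [finrank_fin_fun]; omega)
  rw [finrank_fin_fun] at h
  rw [Finset.prod_Ico_eq_prod_range, Finset.prod_Ico_eq_prod_range, Nat.add_sub_cancel_left, h]
  congr 2
  omega

/-- The hyperplanes of `M` meeting `T` in a flat of codimension one in `T`. -/
def crossingFlats (𝔽 : Type) [Field 𝔽] {n : ℕ} (M T : Set (Fin n → 𝔽)) (k t : ℕ) :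
    Set (Set (Fin n → 𝔽)) :=
  {F | IsFlat 𝔽 k F ∧ F ⊆ M ∧ IsFlat 𝔽 (t - 1) (F ∩ T)}

theorem setOf_mem_crossingFlats {M T : Set (Fin n → 𝔽)} {k t : ℕ} (hM : IsFlat 𝔽 (k + 1) M)
    (hT : IsFlat 𝔽 t T) (hTM : T ⊆ M) {a b : Fin n → 𝔽} (ha : a ∈ T) (hb : b ∈ T) :
    ∃ P : Submodule 𝔽 (Fin n → 𝔽), finrank 𝔽 P = k + 1 ∧ b - a ∈ P ∧
      {F | F ∈ crossingFlats 𝔽 M T k t ∧ a ∈ F ∧ b ∉ F} =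
        flatThrough a '' {Q | Q ≤ P ∧ finrank 𝔽 Q = k ∧ b - a ∉ Q} := by
  obtain ⟨P, hP, rfl⟩ := hM.exists_eq_flatThrough (hTM ha)
  obtain ⟨W, hW, rfl⟩ := hT.exists_eq_flatThrough ha
  have hWP := flatThrough_subset_iff.1 hTM
  refine ⟨P, hP, hTM hb, ?_⟩
  ext F
  constructor
  · rintro ⟨⟨hF, hFM, -⟩, haF, hbF⟩
    obtain ⟨Q, hQ, rfl⟩ := hF.exists_eq_flatThrough haF
    exact ⟨Q, ⟨flatThrough_subset_iff.1 hFM, hQ, hbF⟩, rfl⟩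
  · rintro ⟨Q, ⟨hQP, hQ, hbQ⟩, rfl⟩
    refine ⟨⟨isFlat_flatThrough.2 hQ, flatThrough_subset_iff.2 hQP, ?_⟩,
      self_mem_flatThrough a Q, hbQ⟩
    rw [flatThrough_inter, isFlat_flatThrough]
    have h1 := Submodule.finrank_sup_add_finrank_inf_eq Q W
    have h2 := Submodule.finrank_mono (sup_le hQP hWP)
    have h3 : Q ⊓ W < W := lt_of_le_of_ne inf_le_right fun h =>
      hbQ ((inf_eq_right.1 h) hb)
    have h4 := Submodule.finrank_lt_finrank_of_lt h3
    omega

theorem ncard_crossingFlats [Fintype 𝔽] {M T : Set (Fin n → 𝔽)} {k t : ℕ}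
    (hM : IsFlat 𝔽 (k + 1) M) (hT : IsFlat 𝔽 t T) (hTM : T ⊆ M) :
    (crossingFlats 𝔽 M T k t).ncard *
      (Fintype.card 𝔽 ^ (t - 1) * (Fintype.card 𝔽 ^ t - Fintype.card 𝔽 ^ (t - 1))) =
      (Fintype.card 𝔽 ^ t * Fintype.card 𝔽 ^ t - Fintype.card 𝔽 ^ t) * Fintype.card 𝔽 ^ k := by
  classical
  have hfin : (crossingFlats 𝔽 M T k t).Finite := toFinite _
  have hdc := Finset.sum_card_bipartiteAbove_eq_sum_card_bipartiteBelow
    (fun (F : Set (Fin n → 𝔽)) (z : (Fin n → 𝔽) × (Fin n → 𝔽)) => z.1 ∈ F ∧ z.2 ∉ F)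
    (s := hfin.toFinset) (t := T.toFinset.offDiag)
  have hTc : T.toFinset.card = Fintype.card 𝔽 ^ t := by
    rw [← ncard_eq_toFinset_card', hT.ncard_eq]
  rw [Finset.sum_congr rfl (g := fun _ => Fintype.card 𝔽 ^ (t - 1) *
      (Fintype.card 𝔽 ^ t - Fintype.card 𝔽 ^ (t - 1))) ?_,
    Finset.sum_congr (s₁ := T.toFinset.offDiag) rfl (g := fun _ => Fintype.card 𝔽 ^ k) ?_,
    Finset.sum_const, Finset.sum_const, smul_eq_mul, smul_eq_mul,
    ← ncard_eq_toFinset_card _ hfin, Finset.offDiag_card, hTc] at hdc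
  · exact hdc
  · rintro ⟨a, b⟩ hab
    obtain ⟨ha, hb, hne⟩ : a ∈ T ∧ b ∈ T ∧ a ≠ b := by simpa using hab
    obtain ⟨P, hP, hbP, hset⟩ := setOf_mem_crossingFlats hM hT hTM ha hb
    rw [← card_hyperplane_notMem P k hP hbP (sub_ne_zero.2 hne.symm),
      ← ncard_image_of_injective _ (flatThrough_injective a), ← hset, ← ncard_coe_finset]
    congr 1
    ext F
    simp
  · intro F hF
    obtain ⟨-, -, hFT⟩ : F ∈ crossingFlats 𝔽 M T k t := by simpa using hF
    have heq : Finset.bipartiteAbove (fun (F : Set (Fin n → 𝔽))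
        (z : (Fin n → 𝔽) × (Fin n → 𝔽)) => z.1 ∈ F ∧ z.2 ∉ F) T.toFinset.offDiag F =
        (F ∩ T).toFinset ×ˢ (T \ (F ∩ T)).toFinset := by
      ext ⟨a, b⟩
      simp only [Finset.mem_bipartiteAbove, Finset.mem_offDiag, mem_toFinset, Finset.mem_product,
        mem_inter_iff, mem_sdiff]
      constructor
      · tauto
      · rintro ⟨⟨ha, haT⟩, hbT, hb⟩
        exact ⟨⟨haT, hbT, fun h => hb ⟨h ▸ ha, hbT⟩⟩, ha, fun h => hb ⟨h, hbT⟩⟩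
    rw [heq, Finset.card_product, ← ncard_eq_toFinset_card', ← ncard_eq_toFinset_card',
      ncard_sdiff inter_subset_right, hFT.ncard_eq, hT.ncard_eq]

theorem ncard_A2 [Fintype 𝔽] (p : Fin n → 𝔽) (W : Submodule 𝔽 (Fin n → 𝔽))
    (M : Set (Fin n → 𝔽)) (k : ℕ) (hW : 0 < finrank 𝔽 W) :
    (A2 𝔽 M (flatThrough p W) k (finrank 𝔽 W)).ncard =
      {Q : Submodule 𝔽 (Fin n → 𝔽) | W ≤ Q ∧ finrank 𝔽 Q = k}.ncard +
        (crossingFlats 𝔽 M (flatThrough p W) k (finrank 𝔽 W)).ncard := by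
  have hdis : Disjoint {F | IsFlat 𝔽 k F ∧ flatThrough p W ⊆ F}
      (crossingFlats 𝔽 M (flatThrough p W) k (finrank 𝔽 W)) := by
    rw [Set.disjoint_left]
    rintro F ⟨-, hWF⟩ ⟨-, -, h⟩
    rw [inter_eq_right.2 hWF, isFlat_flatThrough] at h
    omega
  rw [← ncard_image_of_injective _ (flatThrough_injective p), ← setOf_isFlat_flatThrough_subset,
    ← ncard_union_eq hdis]
  rfl

end Flats

theorem stmt_16 (q : ℕ) (hq : IsPrimePow q)
    (𝔽 : Type) [Field 𝔽] [Fintype 𝔽] (hcard : Fintype.card 𝔽 = q)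
    (n k1 k2 t : ℕ) (ht : 0 < t) (hn : k1 + k2 + t + 3 ≤ n)
    (hk12 : k2 < k1) (hk2 : t + 1 ≤ k2)
    (M T : Set (Fin n → 𝔽))
    (hM : IsFlat 𝔽 (k2 + 1) M) (hT : IsFlat 𝔽 t T) (hTM : T ⊆ M)
    (M' T' : Set (Fin n → 𝔽))
    (hM' : IsFlat 𝔽 (k1 + 1) M') (hT' : IsFlat 𝔽 t T') (hT'M' : T' ⊆ M') :
    (A1 𝔽 M' T' k2 t).ncard * (A2 𝔽 M' T' k1 t).ncard
      < (A1 𝔽 M T k1 t).ncard * (A2 𝔽 M T k2 t).ncard := by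
  subst hcard
  set q := Fintype.card 𝔽
  have hq1 : 1 < q := Fintype.one_lt_card
  have hMT := ncard_crossingFlats hM hT hTM
  have hMT' := ncard_crossingFlats hM' hT' hT'M'
  obtain ⟨p, hp⟩ := hT.nonempty
  obtain ⟨W, hW, rfl⟩ := hT.exists_eq_flatThrough hp
  obtain ⟨P, hP, rfl⟩ := hM.exists_eq_flatThrough (hTM hp)
  obtain ⟨p', hp'⟩ := hT'.nonempty
  obtain ⟨W', hW', rfl⟩ := hT'.exists_eq_flatThrough hp'
  obtain ⟨P', hP', rfl⟩ := hM'.exists_eq_flatThrough (hT'M' hp')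
  have hWP := flatThrough_subset_iff.1 hTM
  have hWP' := flatThrough_subset_iff.1 hT'M'
  have e1 := ncard_A1 p hWP k1
  have e2 := ncard_A2 p W (flatThrough p P) k2 (by omega)
  have e1' := ncard_A1 p' hWP' k2
  have e2' := ncard_A2 p' W' (flatThrough p' P') k1 (by omega)
  have hA := ncard_submodule_ge W (k := k1) (by omega) (by omega)
  have hB := ncard_submodule_ge W (k := k2) (by omega) (by omega)
  have hA' := ncard_submodule_ge W' (k := k1) (by omega) (by omega)
  have hB' := ncard_submodule_ge W' (k := k2) (by omega) (by omega)
  have ha := ncard_submodule_inf_eq hWP (k := k1) (by omega) (by omega)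
  have hb := ncard_submodule_inf_eq hWP' (k := k2) (by omega) (by omega)
  have hale : {Q : Submodule 𝔽 (Fin n → 𝔽) | W ≤ Q ∧ finrank 𝔽 Q = k1 ∧ Q ⊓ P = W}.ncard ≤
      {Q : Submodule 𝔽 (Fin n → 𝔽) | W ≤ Q ∧ finrank 𝔽 Q = k1}.ncard :=
    ncard_le_ncard fun Q hQ => ⟨hQ.1, hQ.2.1⟩
  have hble : {Q : Submodule 𝔽 (Fin n → 𝔽) | W' ≤ Q ∧ finrank 𝔽 Q = k2 ∧ Q ⊓ P' = W'}.ncard ≤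
      {Q : Submodule 𝔽 (Fin n → 𝔽) | W' ≤ Q ∧ finrank 𝔽 Q = k2}.ncard :=
    ncard_le_ncard fun Q hQ => ⟨hQ.1, hQ.2.1⟩
  simp only [hW] at e1 e2 hA hB ha
  simp only [hW'] at e1' e2' hA' hB' hb
  rw [hP, show k2 + 1 + k1 - t = k1 + k2 + 1 - t by omega] at ha
  rw [hP', show k1 + 1 + k2 - t = k1 + k2 + 1 - t by omega] at hb
  have hc1 := prod_Ico_pos_of_lt (a := t) hq1 le_rfl (b := k1)
  have hc2 := prod_Ico_pos_of_lt (a := t) hq1 le_rfl (b := k2)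
  have hAA := Nat.eq_of_mul_eq_mul_right hc1 (hA.trans hA'.symm)
  have hBB := Nat.eq_of_mul_eq_mul_right hc2 (hB.trans hB'.symm)
  rw [e1, e2, e1', e2', ← hAA, ← hBB]
  rw [← hBB] at hble
  have hratio := pow_mul_card_le hq1 (by omega) hk12.le (by omega) hA hB ht
  have hlt := prod_avoid_lt hq1 (n := n) (t := t) (k := k2) (l := k1) (e := k1 + k2 + 1 - t)
    (by omega) hk12 (by omega) (by omega)
  refine sub_mul_add_lt hble hale ?_ ?_
  · refine Nat.lt_of_mul_lt_mul_right (a := (∏ i ∈ Finset.Ico t k1, (q ^ k1 - q ^ i)) *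
      ∏ i ∈ Finset.Ico t k2, (q ^ k2 - q ^ i)) ?_
    rw [mul_mul_mul_comm, ha, hB]
    refine hlt.trans_eq ?_
    rw [mul_comm (∏ i ∈ Finset.Ico t k1, (q ^ k1 - q ^ i)), mul_mul_mul_comm, hb, hA]
  · have hpos : 0 < q ^ (t - 1) * (q ^ t - q ^ (t - 1)) :=
      Nat.mul_pos (by positivity)
        (Nat.sub_pos_of_lt (Nat.pow_lt_pow_right hq1 (by omega)))
    have hcross : (crossingFlats 𝔽 (flatThrough p' P') (flatThrough p' W') k1 t).ncard =
        (crossingFlats 𝔽 (flatThrough p P) (flatThrough p W) k2 t).ncard * q ^ (k1 - k2) := by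
      apply Nat.eq_of_mul_eq_mul_right hpos
      rw [hMT', mul_right_comm, hMT, mul_assoc, pow_mul_pow_sub _ hk12.le]
    rw [hcross, mul_assoc]
    exact Nat.mul_le_mul_left _ hratio
end
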